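/- (Existence of Bishop discs by the implicit function theorem) Let α ∈ (0,1), let φ : ∂𝔻 → ℝ be C^{1,α} with φ = 0 on b𝔻⁺ and φ < 0 on b𝔻⁻, and let A : ℂⁿ × ℝ → Mat(n,ℂ) be a C^∞ map with A(z,0) = 0 for all z ∈ ℂⁿ. For z in the Banach space X := C^{1,α}(𝔻̄, ℂⁿ) and parameters (c,t,λ) ∈ ℝⁿ × ℝⁿ × ℝ, define H(z,c,t,λ)(ζ) := ( t_j Sφ(ζ) + i c_j )_{j} + Tg(ζ) − conj( Tg(1/ζ̄) ) where g(ω) := A(z(ω),λ)·conj(∂z/∂ζ(ω)), and let z⁰(c,t)(ζ) := ( t_j Sφ(ζ) + i c_j )_j. Then there exist ε > 0 and δ > 0 such that for every (c,t,λ) with |c| + |t| + |λ| < δ the equation z = H(z,c,t,λ) has a unique solution z(c,t,λ) ∈ X with ‖z(c,t,λ) − z⁰(c,t)‖_X < ε, and the solution map (c,t,λ) ↦ z(c,t,λ) ∈ X is smooth; moreover z(c,0,λ) ≡ i·c (the constant disc) for all admissible c, λ. -/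

import Mathlib

open Metric MeasureTheory

noncomputable section

/-- The Schwarz integral of a (boundary) function `φ`. -/
noncomputable def schwarz (φ : ℂ → ℝ) (ζ : ℂ) : ℂ :=
  (1 / (2 * Real.pi) : ℂ) * ∫ θ in (0 : ℝ)..(2 * Real.pi),
    ((Complex.exp (θ * Complex.I) + ζ) / (Complex.exp (θ * Complex.I) - ζ)) *
      (φ (Complex.exp (θ * Complex.I)) : ℂ)

/-- The (componentwise) Cauchy–Green transform of `f : 𝔻 → ℂⁿ`. -/
noncomputable def cauchyGreenV {n : ℕ} (f : ℂ → Fin n → ℂ) (ζ : ℂ) : Fin n → ℂ :=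
  -(1 / Real.pi : ℂ) • ∫ ω in ball (0 : ℂ) 1, (ω - ζ)⁻¹ • f ω

/-- Componentwise complex conjugation on `ℂⁿ`. -/
def conjVec {n : ℕ} (v : Fin n → ℂ) : Fin n → ℂ := fun i => (starRingEnd ℂ) (v i)

/-- `∂z/∂ζ` (Wirtinger derivative taken within the closed unit disc). -/
noncomputable def wdzD {n : ℕ} (z : ℂ → Fin n → ℂ) (ω : ℂ) : Fin n → ℂ :=
  (1 / 2 : ℂ) • (fderivWithin ℝ z (closedBall (0 : ℂ) 1) ω 1 -
    Complex.I • fderivWithin ℝ z (closedBall (0 : ℂ) 1) ω Complex.I)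

/-- `f` is `α`-Hölder on `K`. -/
def HolderOn {E F : Type*} [NormedAddCommGroup E] [NormedAddCommGroup F]
    (α : ℝ) (f : E → F) (K : Set E) : Prop :=
  ∃ C : ℝ, ∀ x ∈ K, ∀ y ∈ K, ‖f x - f y‖ ≤ C * ‖x - y‖ ^ α

/-- The closed upper semicircle `b𝔻⁺ = {e^{iθ} : θ ∈ [0,π]}`. -/
def upperArc : Set ℂ := {w | ∃ θ ∈ Set.Icc (0 : ℝ) Real.pi, w = Complex.exp (θ * Complex.I)}

/-- The open lower semicircle `b𝔻⁻ = ∂𝔻 ∖ b𝔻⁺`. -/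
def lowerArc : Set ℂ := sphere (0 : ℂ) 1 \ upperArc

/-- Membership in the Banach space `X = C^{1,α}(𝔻̄, ℂⁿ)`: `C¹` on the closed unit disc
with `α`-Hölder first derivatives. -/
def MemX {n : ℕ} (α : ℝ) (f : ℂ → Fin n → ℂ) : Prop :=
  ContDiffOn ℝ 1 f (closedBall (0 : ℂ) 1) ∧
  ∃ K : ℝ, ∀ x ∈ closedBall (0 : ℂ) 1, ∀ y ∈ closedBall (0 : ℂ) 1,
    ‖fderivWithin ℝ f (closedBall (0 : ℂ) 1) x -
      fderivWithin ℝ f (closedBall (0 : ℂ) 1) y‖ ≤ K * ‖x - y‖ ^ α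

/-- The `C^{1,α}`-norm on `X`: sup norm, plus sup norm of the derivative, plus the
`α`-Hölder seminorm of the derivative, all over the closed unit disc. -/
noncomputable def normX {n : ℕ} (α : ℝ) (f : ℂ → Fin n → ℂ) : ℝ :=
  (⨆ ζ : closedBall (0 : ℂ) 1, ‖f (ζ : ℂ)‖) +
  (⨆ ζ : closedBall (0 : ℂ) 1, ‖fderivWithin ℝ f (closedBall (0 : ℂ) 1) (ζ : ℂ)‖) +
  (⨆ p : {p : ℂ × ℂ // p.1 ∈ closedBall (0 : ℂ) 1 ∧ p.2 ∈ closedBall (0 : ℂ) 1 ∧ p.1 ≠ p.2},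
    ‖fderivWithin ℝ f (closedBall (0 : ℂ) 1) p.1.1 -
      fderivWithin ℝ f (closedBall (0 : ℂ) 1) p.1.2‖ / ‖p.1.1 - p.1.2‖ ^ α)

/-- The model disc `z⁰(c,t)(ζ) = (t_j·F(ζ) + i·c_j)_j`, `F` being the continuous
extension of the Schwarz integral `Sφ`. -/
def modelZ {n : ℕ} (F : ℂ → ℂ) (c t : Fin n → ℝ) (ζ : ℂ) : Fin n → ℂ :=
  fun j => (t j : ℂ) * F ζ + Complex.I * (c j : ℂ)

/-- The Bishop operator
`H(z,c,t,λ)(ζ) = (t_j F(ζ) + i c_j)_j + Tg(ζ) − conj(Tg(1/ζ̄))`, with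
`g(ω) = A(z(ω),λ)·conj(∂z/∂ζ(ω))`. -/
noncomputable def bishopH {n : ℕ} (F : ℂ → ℂ)
    (A : (Fin n → ℂ) → ℝ → Matrix (Fin n) (Fin n) ℂ)
    (z : ℂ → Fin n → ℂ) (c t : Fin n → ℝ) (lam : ℝ) (ζ : ℂ) : Fin n → ℂ :=
  modelZ F c t ζ +
    cauchyGreenV (fun ω => (A (z ω) lam).mulVec (conjVec (wdzD z ω))) ζ -
    conjVec (cauchyGreenV (fun ω => (A (z ω) lam).mulVec (conjVec (wdzD z ω)))
      (1 / (starRingEnd ℂ ζ)))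



/-! ### The Hölder space -/

abbrev cD : Set ℂ := closedBall (0 : ℂ) 1

abbrev OffD := {p : ℂ × ℂ // p.1 ∈ cD ∧ p.2 ∈ cD ∧ p.1 ≠ p.2}

abbrev HIdx := cD ⊕ OffD

/-- bounded by `C` and `α`-Hölder with constant `C` on the closed disc -/
def HB {E : Type*} [NormedAddCommGroup E] (α : ℝ) (f : ℂ → E) (C : ℝ) : Prop :=
  (∀ x ∈ cD, ‖f x‖ ≤ C) ∧ ∀ x ∈ cD, ∀ y ∈ cD, ‖f x - f y‖ ≤ C * ‖x - y‖ ^ α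

def HolSub (α : ℝ) (E : Type) [NormedAddCommGroup E] [NormedSpace ℝ E] :
    Submodule ℝ (lp (fun _ : HIdx => E) ⊤) where
  carrier := {f | ∀ p : OffD, f (Sum.inr p) =
    (‖p.1.1 - p.1.2‖ ^ α)⁻¹ • (f (Sum.inl ⟨p.1.1, p.2.1⟩) - f (Sum.inl ⟨p.1.2, p.2.2.1⟩))}
  add_mem' := by
    intro a b ha hb p
    have h1 := ha p
    have h2 := hb p
    simp only [lp.coeFn_add, Pi.add_apply, h1, h2]
    rw [← smul_add]; congr 1; abel
  zero_mem' := by intro p; simp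
  smul_mem' := by
    intro c a ha p
    have h1 := ha p
    simp only [lp.coeFn_smul, Pi.smul_apply, h1]
    rw [← smul_sub, smul_comm]

abbrev Hol (α : ℝ) (E : Type) [NormedAddCommGroup E] [NormedSpace ℝ E] := HolSub α E

theorem HolSub_closed (α : ℝ) (E : Type) [NormedAddCommGroup E] [NormedSpace ℝ E] :
    IsClosed (HolSub α E : Set (lp (fun _ : HIdx => E) ⊤)) := by
  have : (HolSub α E : Set (lp (fun _ : HIdx => E) ⊤)) = ⋂ p : OffD,
    {f | f (Sum.inr p) =
    (‖p.1.1 - p.1.2‖ ^ α)⁻¹ • (f (Sum.inl ⟨p.1.1, p.2.1⟩) - f (Sum.inl ⟨p.1.2, p.2.2.1⟩))} := by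
    ext f; simp only [Set.mem_iInter]; rfl
  rw [this]
  refine isClosed_iInter fun p => isClosed_eq ?_ ?_
  · exact (lp.lipschitzWith_one_eval (E := fun _ : HIdx => E) ⊤ (Sum.inr p)).continuous
  · refine Continuous.const_smul (Continuous.sub ?_ ?_) _
    · exact (lp.lipschitzWith_one_eval (E := fun _ : HIdx => E) ⊤ _).continuous
    · exact (lp.lipschitzWith_one_eval (E := fun _ : HIdx => E) ⊤ _).continuous

instance HolComplete (α : ℝ) (E : Type) [NormedAddCommGroup E] [NormedSpace ℝ E]
    [CompleteSpace E] : CompleteSpace (Hol α E) :=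
  (HolSub_closed α E).completeSpace_coe

section
variable {α : ℝ} {E : Type} [NormedAddCommGroup E] [NormedSpace ℝ E]

open Classical in
/-- evaluation -/
def ev (g : Hol α E) (x : ℂ) : E := if h : x ∈ cD then g.1 (Sum.inl ⟨x, h⟩) else 0

theorem ev_of_mem (g : Hol α E) {x : ℂ} (h : x ∈ cD) : ev g x = g.1 (Sum.inl ⟨x, h⟩) := by
  simp [ev, h]

theorem norm_ev_le (g : Hol α E) (x : ℂ) : ‖ev g x‖ ≤ ‖g‖ := by
  unfold ev
  split_ifs with h
  · exact lp.norm_apply_le_norm (by simp) g.1 _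
  · simp

theorem rpow_dist_pos {x y : ℂ} (h : x ≠ y) (a : ℝ) : 0 < ‖x - y‖ ^ a :=
  Real.rpow_pos_of_pos (norm_pos_iff.2 (sub_ne_zero.2 h)) _

theorem ev_holder (g : Hol α E) {x y : ℂ} (hx : x ∈ cD) (hy : y ∈ cD) :
    ‖ev g x - ev g y‖ ≤ ‖g‖ * ‖x - y‖ ^ α := by
  by_cases h : x = y
  · subst h; simp; positivity
  · have h1 := g.2 ⟨(x, y), hx, hy, h⟩
    have h2 := lp.norm_apply_le_norm (by simp) g.1 (Sum.inr ⟨(x, y), hx, hy, h⟩)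
    have h3 := rpow_dist_pos h α
    rw [h1] at h2
    simp only [norm_smul, norm_inv, Real.norm_of_nonneg h3.le] at h2
    rw [ev_of_mem g hx, ev_of_mem g hy]
    rw [inv_mul_le_iff₀ h3] at h2
    rw [mul_comm]; exact h2

theorem ev_HB (g : Hol α E) : HB α (ev g) ‖g‖ :=
  ⟨fun x _ => norm_ev_le g x, fun _ hx _ hy => ev_holder g hx hy⟩

theorem Hol_ext {g g' : Hol α E} (h : ∀ x ∈ cD, ev g x = ev g' x) : g = g' := by
  apply Subtype.ext
  apply lp.ext
  have h0 : ∀ x : cD, g.1 (Sum.inl x) = g'.1 (Sum.inl x) := by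
    intro x
    have := h x.1 x.2
    rwa [ev_of_mem g x.2, ev_of_mem g' x.2] at this
  funext i
  rcases i with x | p
  · exact h0 x
  · rw [g.2 p, g'.2 p, h0, h0]

open Classical in
/-- raw data of a Hölder function -/
def rawH (α : ℝ) (f : ℂ → E) : HIdx → E
  | Sum.inl x => f x
  | Sum.inr p => (‖p.1.1 - p.1.2‖ ^ α)⁻¹ • (f p.1.1 - f p.1.2)

theorem rawH_le {f : ℂ → E} {C : ℝ} (h : HB α f C) (i : HIdx) : ‖rawH α f i‖ ≤ C := by
  rcases i with x | p
  · exact h.1 x.1 x.2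
  · have h3 := rpow_dist_pos p.2.2.2 α
    simp only [rawH, norm_smul, norm_inv, Real.norm_of_nonneg h3.le]
    rw [inv_mul_le_iff₀ h3, mul_comm]
    exact h.2 _ p.2.1 _ p.2.2.1

open Classical in
def toHol (α : ℝ) (f : ℂ → E) : Hol α E :=
  if h : ∃ C, HB α f C then
    ⟨⟨rawH α f, memℓp_infty (by
      obtain ⟨C, hC⟩ := h
      exact ⟨C, by rintro _ ⟨i, rfl⟩; exact rawH_le hC i⟩)⟩, fun p => rfl⟩
  else 0

theorem ev_toHol {f : ℂ → E} {C : ℝ} (h : HB α f C) {x : ℂ} (hx : x ∈ cD) :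
    ev (toHol α f) x = f x := by
  rw [ev_of_mem _ hx, toHol, dif_pos ⟨C, h⟩]; rfl

theorem zero_mem_cD : (0 : ℂ) ∈ cD := by simp [cD]

theorem HB.nonneg {f : ℂ → E} {C : ℝ} (h : HB α f C) : 0 ≤ C :=
  (norm_nonneg _).trans (h.1 0 zero_mem_cD)

theorem norm_toHol_le {f : ℂ → E} {C : ℝ} (h : HB α f C) : ‖toHol α f‖ ≤ C := by
  rw [toHol, dif_pos ⟨C, h⟩]
  exact lp.norm_le_of_forall_le h.nonneg (fun i => rawH_le h i)

theorem norm_Hol_le {g : Hol α E} {C : ℝ} (h : HB α (ev g) C) : ‖g‖ ≤ C := by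
  have : g = toHol α (ev g) := Hol_ext fun x hx => (ev_toHol h hx).symm
  rw [this]; exact norm_toHol_le h

theorem ev_add (g g' : Hol α E) (x : ℂ) : ev (g + g') x = ev g x + ev g' x := by
  unfold ev; split_ifs <;> simp

theorem ev_sub (g g' : Hol α E) (x : ℂ) : ev (g - g') x = ev g x - ev g' x := by
  unfold ev; split_ifs <;> simp

theorem ev_smul (c : ℝ) (g : Hol α E) (x : ℂ) : ev (c • g) x = c • ev g x := by
  unfold ev; split_ifs <;> simp

theorem ev_zero (x : ℂ) : ev (0 : Hol α E) x = 0 := by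
  unfold ev; split_ifs <;> simp

/-- evaluation as a continuous linear map -/
def evL (α : ℝ) (E : Type) [NormedAddCommGroup E] [NormedSpace ℝ E] (x : ℂ) : Hol α E →L[ℝ] E :=
  LinearMap.mkContinuous
    { toFun := fun g => ev g x
      map_add' := fun g g' => ev_add g g' x
      map_smul' := fun c g => ev_smul c g x } 1
    (fun g => by rw [one_mul]; exact norm_ev_le g x)

theorem evL_apply (g : Hol α E) (x : ℂ) : evL α E x g = ev g x := rfl

theorem ev_continuousOn (hα : 0 < α) (g : Hol α E) : ContinuousOn (ev g) cD := by
  intro x hx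
  rw [ContinuousWithinAt, tendsto_iff_norm_sub_tendsto_zero]
  have h1 : Filter.Tendsto (fun y : ℂ => ‖g‖ * ‖y - x‖ ^ α) (nhdsWithin x cD) (nhds 0) := by
    have : Continuous (fun y : ℂ => ‖g‖ * ‖y - x‖ ^ α) :=
      continuous_const.mul ((continuous_id.sub continuous_const).norm.rpow_const
        (fun _ => Or.inr hα.le))
    have h2 := this.tendsto x
    simp only [sub_self, norm_zero, Real.zero_rpow hα.ne', mul_zero] at h2
    exact h2.mono_left nhdsWithin_le_nhds
  refine squeeze_zero' (Filter.Eventually.of_forall fun _ => norm_nonneg _) ?_ h1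
  filter_upwards [self_mem_nhdsWithin] with y hy
  exact ev_holder g hy hx

end

/-! ### Superposition operators -/

section
variable {α : ℝ} {E : Type} [NormedAddCommGroup E] [NormedSpace ℝ E]
  {F : Type} [NormedAddCommGroup F] [NormedSpace ℝ F]

theorem HB_clm (a : Hol α (E →L[ℝ] F)) (u : Hol α E) :
    HB α (fun x => ev a x (ev u x)) (2 * ‖a‖ * ‖u‖) := by
  constructor
  · intro x hx
    calc ‖ev a x (ev u x)‖ ≤ ‖ev a x‖ * ‖ev u x‖ := ContinuousLinearMap.le_opNorm _ _
      _ ≤ ‖a‖ * ‖u‖ := by gcongr; exacts [norm_ev_le a x, norm_ev_le u x]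
      _ ≤ 2 * ‖a‖ * ‖u‖ := by nlinarith [mul_nonneg (norm_nonneg a) (norm_nonneg u)]
  · intro x hx y hy
    have e : ev a x (ev u x) - ev a y (ev u y) =
      (ev a x - ev a y) (ev u x) + ev a y (ev u x - ev u y) := by simp
    rw [e]
    calc _ ≤ ‖(ev a x - ev a y) (ev u x)‖ + ‖ev a y (ev u x - ev u y)‖ := norm_add_le _ _
      _ ≤ ‖ev a x - ev a y‖ * ‖ev u x‖ + ‖ev a y‖ * ‖ev u x - ev u y‖ := by
        gcongr <;> exact ContinuousLinearMap.le_opNorm _ _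
      _ ≤ (‖a‖ * ‖x - y‖ ^ α) * ‖u‖ + ‖a‖ * (‖u‖ * ‖x - y‖ ^ α) := by
        gcongr
        exacts [ev_holder a hx hy, norm_ev_le u x, norm_ev_le a y, ev_holder u hx hy]
      _ = _ := by ring

/-- pointwise application -/
def mulH (α : ℝ) (E F : Type) [NormedAddCommGroup E] [NormedSpace ℝ E]
    [NormedAddCommGroup F] [NormedSpace ℝ F] :
    Hol α (E →L[ℝ] F) →L[ℝ] Hol α E →L[ℝ] Hol α F :=
  LinearMap.mkContinuous₂
    (LinearMap.mk₂ ℝ (fun (a : Hol α (E →L[ℝ] F)) (u : Hol α E) =>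
        toHol α (fun x => ev a x (ev u x)))
      (by
        intro a b u
        apply Hol_ext; intro x hx
        rw [ev_add, ev_toHol (HB_clm _ _) hx, ev_toHol (HB_clm _ _) hx, ev_toHol (HB_clm _ _) hx,
          ev_add]; simp)
      (by
        intro c a u
        apply Hol_ext; intro x hx
        rw [ev_smul, ev_toHol (HB_clm _ _) hx, ev_toHol (HB_clm _ _) hx, ev_smul]; simp)
      (by
        intro a u v
        apply Hol_ext; intro x hx
        rw [ev_add, ev_toHol (HB_clm _ _) hx, ev_toHol (HB_clm _ _) hx, ev_toHol (HB_clm _ _) hx,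
          ev_add]; simp)
      (by
        intro c a u
        apply Hol_ext; intro x hx
        rw [ev_smul, ev_toHol (HB_clm _ _) hx, ev_toHol (HB_clm _ _) hx, ev_smul]; simp)) 2
    (by intro a u; exact norm_toHol_le (HB_clm a u))

theorem ev_mulH (a : Hol α (E →L[ℝ] F)) (u : Hol α E) {x : ℂ} (hx : x ∈ cD) :
    ev (mulH α E F a u) x = ev a x (ev u x) := ev_toHol (HB_clm a u) hx

def nem (α : ℝ) (f : E → F) (u : Hol α E) : Hol α F := toHol α (fun x => f (ev u x))

theorem lip_on_ball [ProperSpace E] {f : E → F} (hf : ContDiff ℝ (⊤ : ℕ∞) f) (R : ℝ) :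
    ∃ L : ℝ, 0 ≤ L ∧ (∀ x ∈ closedBall (0 : E) R, ‖f x‖ ≤ L) ∧
    ∀ x ∈ closedBall (0 : E) R, ∀ y ∈ closedBall (0 : E) R, ‖f x - f y‖ ≤ L * ‖x - y‖ := by
  have hc : Continuous (fderiv ℝ f) := hf.continuous_fderiv (by simp)
  obtain ⟨L, hL⟩ := (isCompact_closedBall (0 : E) R).exists_bound_of_continuousOn hc.continuousOn
  obtain ⟨L', hL'⟩ := (isCompact_closedBall (0 : E) R).exists_bound_of_continuousOn
    hf.continuous.continuousOn
  refine ⟨max (max L L') 0, le_max_right _ _, ?_, ?_⟩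
  · intro x hx; exact (hL' x hx).trans ((le_max_right _ _).trans (le_max_left _ _))
  intro x hx y hy
  refine (convex_closedBall (0 : E) R).norm_image_sub_le_of_norm_fderiv_le (𝕜 := ℝ)
    (fun z _ => (hf.differentiable (by simp)).differentiableAt)
    (fun z hz => (hL z hz).trans ((le_max_left _ _).trans (le_max_left _ _))) hy hx

theorem HB_nem [ProperSpace E] {f : E → F} (hf : ContDiff ℝ (⊤ : ℕ∞) f) (u : Hol α E) :
    ∃ C, HB α (fun x => f (ev u x)) C := by
  obtain ⟨L, h0, h1, h2⟩ := lip_on_ball hf ‖u‖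
  have hb : ∀ x, ev u x ∈ closedBall (0 : E) ‖u‖ := fun x => by
    simpa using norm_ev_le u x
  refine ⟨max L (L * ‖u‖), fun x _ => (h1 _ (hb x)).trans (le_max_left _ _), ?_⟩
  intro x hx y hy
  calc _ ≤ L * ‖ev u x - ev u y‖ := h2 _ (hb x) _ (hb y)
    _ ≤ L * (‖u‖ * ‖x - y‖ ^ α) := by gcongr; exact ev_holder u hx hy
    _ = L * ‖u‖ * ‖x - y‖ ^ α := by ring
    _ ≤ _ := by gcongr; exact le_max_right _ _

theorem ev_nem [ProperSpace E] {f : E → F} (hf : ContDiff ℝ (⊤ : ℕ∞) f) (u : Hol α E)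
    {x : ℂ} (hx : x ∈ cD) : ev (nem α f u) x = f (ev u x) := by
  obtain ⟨C, hC⟩ := HB_nem hf u
  exact ev_toHol hC hx

theorem taylor_rem [ProperSpace E] {f : E → F} (hf : ContDiff ℝ (⊤ : ℕ∞) f) (R : ℝ) :
    ∃ C : ℝ, 0 ≤ C ∧ ∀ s : ℝ, 0 ≤ s → s ≤ 1 → ∀ x y k l : E, ‖x‖ ≤ R → ‖y‖ ≤ R →
      ‖k‖ ≤ s → ‖l‖ ≤ s →
      ‖(f (x + k) - f x - fderiv ℝ f x k) - (f (y + l) - f y - fderiv ℝ f y l)‖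
        ≤ C * (s ^ 2 * ‖x - y‖ + s * ‖k - l‖) := by
  have hf1 : ContDiff ℝ (⊤ : ℕ∞) (fderiv ℝ f) := hf.fderiv_right (by simp)
  have hf2 : ContDiff ℝ (⊤ : ℕ∞) (fderiv ℝ (fderiv ℝ f)) := hf1.fderiv_right (by simp)
  obtain ⟨L1, h10, -, h1⟩ := lip_on_ball hf1 (R + 1)
  obtain ⟨L2, h20, -, h2⟩ := lip_on_ball hf2 (R + 1)
  have hd : ∀ z, HasFDerivAt f (fderiv ℝ f z) z :=
    fun z => (hf.differentiable (by simp)).differentiableAt.hasFDerivAt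
  have hd1 : ∀ z, HasFDerivAt (fderiv ℝ f) (fderiv ℝ (fderiv ℝ f) z) z :=
    fun z => (hf1.differentiable (by simp)).differentiableAt.hasFDerivAt
  refine ⟨max L1 L2, h10.trans (le_max_left _ _), ?_⟩
  intro s hs0 hs1 x y k l hx hy hk hl
  have A1 : ‖(f (x + k) - f x - fderiv ℝ f x k) - (f (y + k) - f y - fderiv ℝ f y k)‖
      ≤ (L2 * s * s) * ‖x - y‖ := by
    refine (convex_closedBall (0 : E) R).norm_image_sub_le_of_norm_hasFDerivWithin_le (𝕜 := ℝ)
      (f := fun x => f (x + k) - f x - fderiv ℝ f x k)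
      (f' := fun x => fderiv ℝ f (x + k) - fderiv ℝ f x - (fderiv ℝ (fderiv ℝ f) x).flip k)
      (s := closedBall (0 : E) R) ?_ ?_ (by simpa using hy) (by simpa using hx)
    · intro z hz
      apply HasFDerivAt.hasFDerivWithinAt
      refine (HasFDerivAt.sub ?_ (hd z)).sub ?_
      · have h3 := (hd (z + k)).comp z ((hasFDerivAt_id z).add_const k)
        simpa [Function.comp_def] using h3
      · have := (hd1 z).clm_apply (hasFDerivAt_const k z)
        convert this using 1
        ext v; simp
    · intro z hz
      have hz' : ‖z‖ ≤ R := by simpa using hz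
      have e : fderiv ℝ (fderiv ℝ f) z k = (fderiv ℝ (fderiv ℝ f) z).flip k := by
        ext v
        simp only [ContinuousLinearMap.flip_apply]
        exact (hf.contDiffAt.isSymmSndFDerivAt (x := z)
          (by simpa using (by exact_mod_cast le_top : ((2 : ℕ∞) : WithTop ℕ∞) ≤ ((⊤ : ℕ∞) : WithTop ℕ∞)))).eq k v
      rw [← e]
      have := (convex_closedBall z s).norm_image_sub_le_of_norm_hasFDerivWithin_le' (𝕜 := ℝ)
        (f := fderiv ℝ f) (f' := fun y => fderiv ℝ (fderiv ℝ f) y)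
        (φ := fderiv ℝ (fderiv ℝ f) z) (C := L2 * s) (x := z) (y := z + k)
        (fun w _ => (hd1 w).hasFDerivWithinAt)
        (fun w hw => ?_) (by simp [hs0]) (by simpa using hk)
      · simp only [add_sub_cancel_left] at this
        exact this.trans (by gcongr)
      · have hw' : ‖w - z‖ ≤ s := by simpa [dist_eq_norm] using hw
        refine (h2 w ?_ z ?_).trans (by gcongr)
        · have : ‖w‖ ≤ ‖w - z‖ + ‖z‖ := by simpa using norm_add_le (w - z) z
          simp; linarith
        · simp; linarith
  have A2 : ‖(f (y + k) - f y - fderiv ℝ f y k) - (f (y + l) - f y - fderiv ℝ f y l)‖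
      ≤ (L1 * s) * ‖k - l‖ := by
    have := (convex_closedBall y s).norm_image_sub_le_of_norm_hasFDerivWithin_le' (𝕜 := ℝ)
        (f := f) (f' := fun y => fderiv ℝ f y)
        (φ := fderiv ℝ f y) (C := L1 * s) (x := y + l) (y := y + k)
        (fun w _ => (hd w).hasFDerivWithinAt)
        (fun w hw => ?_) (by simpa using hl) (by simpa using hk)
    · have e : (f (y + k) - f y - fderiv ℝ f y k) - (f (y + l) - f y - fderiv ℝ f y l) =
        f (y + k) - f (y + l) - fderiv ℝ f y (y + k - (y + l)) := by
        rw [add_sub_add_left_eq_sub, map_sub]; abel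
      rw [e]
      simpa [add_sub_add_left_eq_sub] using this
    · have hw' : ‖w - y‖ ≤ s := by simpa [dist_eq_norm] using hw
      refine (h1 w ?_ y ?_).trans (by gcongr)
      · have : ‖w‖ ≤ ‖w - y‖ + ‖y‖ := by simpa using norm_add_le (w - y) y
        simp; linarith
      · simp; linarith
  calc _ ≤ _ := norm_sub_le_norm_sub_add_norm_sub _
            (f (y + k) - f y - fderiv ℝ f y k) _
    _ ≤ (L2 * s * s) * ‖x - y‖ + (L1 * s) * ‖k - l‖ := add_le_add A1 A2
    _ ≤ (max L1 L2 * s * s) * ‖x - y‖ + (max L1 L2 * s) * ‖k - l‖ := by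
      gcongr; exacts [le_max_right _ _, le_max_left _ _]
    _ = _ := by ring

theorem nem_hasFDerivAt [ProperSpace E] {f : E → F} (hf : ContDiff ℝ (⊤ : ℕ∞) f) (u : Hol α E) :
    HasFDerivAt (nem α f) (mulH α E F (nem α (fderiv ℝ f) u)) u := by
  have hf1 : ContDiff ℝ (⊤ : ℕ∞) (fderiv ℝ f) := hf.fderiv_right (by simp)
  obtain ⟨C, hC0, hC⟩ := taylor_rem hf ‖u‖
  rw [hasFDerivAt_iff_isLittleO_nhds_zero]
  have key : ∀ h : Hol α E, ‖h‖ ≤ 1 →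
      ‖nem α f (u + h) - nem α f u - mulH α E F (nem α (fderiv ℝ f) u) h‖ ≤
        C * (‖u‖ + 1) * ‖h‖ ^ 2 := by
    intro h h1
    have e : ∀ x ∈ cD, ev (nem α f (u + h) - nem α f u - mulH α E F (nem α (fderiv ℝ f) u) h) x
        = f (ev u x + ev h x) - f (ev u x) - fderiv ℝ f (ev u x) (ev h x) := by
      intro x hx
      rw [ev_sub, ev_sub, ev_mulH _ _ hx, ev_nem hf _ hx, ev_nem hf _ hx, ev_nem hf1 _ hx, ev_add]
    apply norm_Hol_le
    constructor
    · intro x hx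
      rw [e x hx]
      have := hC ‖h‖ (norm_nonneg _) h1 (ev u x) (ev u x) (ev h x) 0 (norm_ev_le u x)
        (norm_ev_le u x) (norm_ev_le h x) (by simp)
      simp only [sub_self, norm_zero, mul_zero, zero_add, sub_zero, add_zero, map_zero] at this
      refine this.trans ?_
      have h2 := norm_ev_le h x
      calc C * (‖h‖ * ‖ev h x‖) ≤ C * (‖h‖ * ‖h‖) := by gcongr
        _ = C * 1 * ‖h‖ ^ 2 := by ring
        _ ≤ _ := by gcongr; linarith [norm_nonneg u]
    · intro x hx y hy
      rw [e x hx, e y hy]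
      refine (hC ‖h‖ (norm_nonneg _) h1 (ev u x) (ev u y) (ev h x) (ev h y) (norm_ev_le u x)
        (norm_ev_le u y) (norm_ev_le h x) (norm_ev_le h y)).trans ?_
      calc _ ≤ C * (‖h‖ ^ 2 * (‖u‖ * ‖x - y‖ ^ α) + ‖h‖ * (‖h‖ * ‖x - y‖ ^ α)) := by
            gcongr; exacts [ev_holder u hx hy, ev_holder h hx hy]
        _ = _ := by ring
  have hO : (fun h : Hol α E => nem α f (u + h) - nem α f u -
      mulH α E F (nem α (fderiv ℝ f) u) h) =O[nhds 0] fun h : Hol α E => ‖h‖ ^ 2 := by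
    apply Asymptotics.IsBigO.of_bound (C * (‖u‖ + 1))
    filter_upwards [Metric.closedBall_mem_nhds (0 : Hol α E) one_pos] with h hh
    have := key h (by simpa using hh)
    simpa using this
  refine hO.trans_isLittleO ?_
  exact Asymptotics.isLittleO_norm_pow_id one_lt_two

theorem nem_contDiff_nat [ProperSpace E] (m : ℕ) : ∀ (F : Type) [NormedAddCommGroup F]
    [NormedSpace ℝ F] (f : E → F), ContDiff ℝ (⊤ : ℕ∞) f → ContDiff ℝ m (nem α f) := by
  induction m with
  | zero =>
    intro F _ _ f hf
    simp only [Nat.cast_zero, contDiff_zero]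
    exact continuous_iff_continuousAt.2 fun u => (nem_hasFDerivAt hf u).continuousAt
  | succ m ih =>
    intro F _ _ f hf
    rw [Nat.cast_succ, contDiff_succ_iff_hasFDerivAt]
    refine ⟨fun u => mulH α E F (nem α (fderiv ℝ f) u), ?_, nem_hasFDerivAt hf⟩
    exact (ContinuousLinearMap.contDiff (𝕜 := ℝ) (E := Hol α (E →L[ℝ] F))
      (F := Hol α E →L[ℝ] Hol α F) (mulH α E F)).comp (ih _ _ (hf.fderiv_right (by simp)))

theorem nem_contDiff [ProperSpace E] {f : E → F} (hf : ContDiff ℝ (⊤ : ℕ∞) f) :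
    ContDiff ℝ (⊤ : ℕ∞) (nem α f) :=
  contDiff_infty.2 fun m => nem_contDiff_nat m F f hf

end


/-! ### Integral estimates -/

def Lp' (R p : ℝ) (x : ℂ) : ℝ := (Set.Iic R).indicator (fun y : ℝ => y ^ p) ‖x‖
def Gp' (R p : ℝ) (x : ℂ) : ℝ := (Set.Ioi R).indicator (fun y : ℝ => y ^ p) ‖x‖

def vD : ℝ := 2 * volume.real (ball (0 : ℂ) 1)

theorem vD_nonneg : 0 ≤ vD := by unfold vD; positivity

theorem radial_aux1 (p : ℝ) (s : Set ℝ) :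
    ∀ y ∈ Set.Ioi (0 : ℝ), y ^ (Module.finrank ℝ ℂ - 1) • s.indicator (fun y : ℝ => y ^ p) y
      = s.indicator (fun y : ℝ => y ^ (p + 1)) y := by
  intro y hy
  have hy' : (0 : ℝ) < y := hy
  by_cases h : y ∈ s
  · simp [h, Real.rpow_add hy', mul_comm]
  · simp [h]

theorem Lp_int {R p : ℝ} (hR : 0 < R) (hp : -2 < p) : Integrable (Lp' R p) ∧
    ∫ x, Lp' R p x = vD * (R ^ (p + 2) / (p + 2)) := by
  have h1 : IntegrableOn (fun y : ℝ => y ^ (p + 1)) (Set.Ioc 0 R) := by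
    rw [← intervalIntegrable_iff_integrableOn_Ioc_of_le hR.le]
    exact intervalIntegral.intervalIntegrable_rpow' (by linarith)
  have hset : Set.Ioi (0 : ℝ) ∩ Set.Iic R = Set.Ioc 0 R := by ext; simp
  constructor
  · unfold Lp'
    rw [integrable_fun_norm_addHaar (volume : Measure ℂ)
      (f := (Set.Iic R).indicator (fun y : ℝ => y ^ p)),
      integrableOn_congr_fun (radial_aux1 p _) measurableSet_Ioi,
      integrableOn_indicator_iff measurableSet_Iic, Set.inter_comm, hset]
    exact h1
  · unfold Lp'
    rw [integral_fun_norm_addHaar (volume : Measure ℂ)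
      (f := (Set.Iic R).indicator (fun y : ℝ => y ^ p)),
      setIntegral_congr_fun measurableSet_Ioi (radial_aux1 p _),
      setIntegral_indicator measurableSet_Iic, hset, ← intervalIntegral.integral_of_le hR.le,
      integral_rpow (Or.inl (by linarith))]
    rw [Real.zero_rpow (by linarith), Complex.finrank_real_complex]
    simp only [vD, nsmul_eq_mul, smul_eq_mul, sub_zero]
    rw [show p + 1 + 1 = p + 2 by ring]
    push_cast; ring

theorem Gp_int {R p : ℝ} (hR : 0 < R) (hp : p < -2) : Integrable (Gp' R p) ∧
    ∫ x, Gp' R p x = vD * (-R ^ (p + 2) / (p + 2)) := by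
  have h1 : IntegrableOn (fun y : ℝ => y ^ (p + 1)) (Set.Ioi R) :=
    integrableOn_Ioi_rpow_of_lt (by linarith) hR
  have hset : Set.Ioi (0 : ℝ) ∩ Set.Ioi R = Set.Ioi R := by
    ext; simp; intro h; linarith
  constructor
  · unfold Gp'
    rw [integrable_fun_norm_addHaar (volume : Measure ℂ)
      (f := (Set.Ioi R).indicator (fun y : ℝ => y ^ p)),
      integrableOn_congr_fun (radial_aux1 p _) measurableSet_Ioi,
      integrableOn_indicator_iff measurableSet_Ioi, Set.inter_comm, hset]
    exact h1
  · unfold Gp'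
    rw [integral_fun_norm_addHaar (volume : Measure ℂ)
      (f := (Set.Ioi R).indicator (fun y : ℝ => y ^ p)),
      setIntegral_congr_fun measurableSet_Ioi (radial_aux1 p _),
      setIntegral_indicator measurableSet_Ioi, hset, integral_Ioi_rpow_of_lt (by linarith) hR,
      Complex.finrank_real_complex]
    simp only [vD, nsmul_eq_mul, smul_eq_mul]
    rw [show p + 1 + 1 = p + 2 by ring]
    push_cast; ring

theorem Lp_nonneg (R p : ℝ) (x : ℂ) : 0 ≤ Lp' R p x := by
  unfold Lp'; apply Set.indicator_apply_nonneg; intro _; positivity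

theorem Gp_nonneg (R p : ℝ) (x : ℂ) : 0 ≤ Gp' R p x := by
  unfold Gp'; apply Set.indicator_apply_nonneg; intro _; positivity

theorem key_bound {α : ℝ} (hα : α ∈ Set.Ioo (0 : ℝ) 1) :
    ∃ C : ℝ, 0 ≤ C ∧ ∀ ζ ζ' : ℂ, ζ ≠ ζ' → ∃ B : ℂ → ℝ, Integrable B ∧
      (∀ ω, ‖ω - ζ‖ ^ (α - 2) * ‖ω - ζ'‖⁻¹ ≤ B ω) ∧ ∫ ω, B ω ≤ C * ‖ζ' - ζ‖ ^ (α - 1) := by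
  obtain ⟨h0, h1⟩ := hα
  refine ⟨vD * ((1 / 2) ^ (α - 1) + 2 * (2 ^ α / α) + 2 * (2 ^ (α - 1) / (1 - α))), ?_, ?_⟩
  · have := vD_nonneg
    have : 0 < 1 - α := by linarith
    positivity
  intro ζ ζ' hne
  set r := ‖ζ' - ζ‖ with hr
  have hr0 : 0 < r := norm_pos_iff.2 (sub_ne_zero.2 hne.symm)
  obtain ⟨i1, e1⟩ := Lp_int (R := r / 2) (p := -1) (by positivity) (by norm_num)
  obtain ⟨i2, e2⟩ := Lp_int (R := 2 * r) (p := α - 2) (by positivity) (by linarith)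
  obtain ⟨i3, e3⟩ := Gp_int (R := 2 * r) (p := α - 3) (by positivity) (by linarith)
  have j1 := (i1.comp_sub_right ζ').const_mul ((r / 2) ^ (α - 2))
  have j2 := (i2.comp_sub_right ζ).const_mul (2 / r)
  have j3 := (i3.comp_sub_right ζ).const_mul 2
  refine ⟨fun ω => (r / 2) ^ (α - 2) * Lp' (r / 2) (-1) (ω - ζ') +
    2 / r * Lp' (2 * r) (α - 2) (ω - ζ) + 2 * Gp' (2 * r) (α - 3) (ω - ζ), (j1.add j2).add j3,
    ?_, ?_⟩
  · intro ω
    have n1 := mul_nonneg (Real.rpow_nonneg (x := r / 2) (by positivity) (α - 2))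
      (Lp_nonneg (r / 2) (-1) (ω - ζ'))
    have n2 := mul_nonneg (a := 2 / r) (by positivity) (Lp_nonneg (2 * r) (α - 2) (ω - ζ))
    have n3 := mul_nonneg (a := 2) (by positivity) (Gp_nonneg (2 * r) (α - 3) (ω - ζ))
    have t1 : r ≤ ‖ω - ζ‖ + ‖ω - ζ'‖ := by
      rw [hr]; have := norm_sub_le (ω - ζ) (ω - ζ'); simpa using this
    have t2 : ‖ω - ζ‖ ≤ ‖ω - ζ'‖ + r := by
      have := norm_add_le (ω - ζ') (ζ' - ζ); simpa using this
    have ha := norm_nonneg (ω - ζ)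
    have hb := norm_nonneg (ω - ζ')
    set a := ‖ω - ζ‖ with haa
    set b := ‖ω - ζ'‖ with hbb
    by_cases c1 : b ≤ r / 2
    · have : a ^ (α - 2) * b⁻¹ ≤ (r / 2) ^ (α - 2) * Lp' (r / 2) (-1) (ω - ζ') := by
        have e : Lp' (r / 2) (-1) (ω - ζ') = b⁻¹ := by
          rw [Lp', Set.indicator_of_mem (by simpa using c1), Real.rpow_neg_one]
        rw [e]
        exact mul_le_mul_of_nonneg_right
          (Real.rpow_le_rpow_of_nonpos (half_pos hr0) (by linarith) (by linarith))
          (inv_nonneg.2 hb)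
      simp only []; linarith
    · push Not at c1
      by_cases c2 : a ≤ 2 * r
      · have : a ^ (α - 2) * b⁻¹ ≤ 2 / r * Lp' (2 * r) (α - 2) (ω - ζ) := by
          have e : Lp' (2 * r) (α - 2) (ω - ζ) = a ^ (α - 2) := by
            rw [Lp', Set.indicator_of_mem (by simpa using c2)]
          rw [e, mul_comm]
          gcongr
          rw [show 2 / r = (r / 2)⁻¹ by simp]
          gcongr
        simp only []; linarith
      · push Not at c2
        have : a ^ (α - 2) * b⁻¹ ≤ 2 * Gp' (2 * r) (α - 3) (ω - ζ) := by
          have e : Gp' (2 * r) (α - 3) (ω - ζ) = a ^ (α - 3) := by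
            rw [Gp', Set.indicator_of_mem (by simpa using c2)]
          have a0 : 0 < a := by linarith
          rw [e, show α - 3 = (α - 2) - 1 by ring, Real.rpow_sub_one a0.ne']
          have : b⁻¹ ≤ 2 / a := by
            rw [show 2 / a = (a / 2)⁻¹ by simp]
            gcongr; linarith
          calc _ ≤ a ^ (α - 2) * (2 / a) := by gcongr
            _ = _ := by ring
        simp only []; linarith
  · have j12 : Integrable (fun ω => (r / 2) ^ (α - 2) * Lp' (r / 2) (-1) (ω - ζ') +
      2 / r * Lp' (2 * r) (α - 2) (ω - ζ)) := j1.add j2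
    rw [integral_add j12 j3, integral_add j1 j2, integral_const_mul, integral_const_mul,
      integral_const_mul, integral_sub_right_eq_self (Lp' (r / 2) (-1)),
      integral_sub_right_eq_self (Lp' (2 * r) (α - 2)),
      integral_sub_right_eq_self (Gp' (2 * r) (α - 3)), e1, e2, e3]
    apply le_of_eq
    have p1 : (r / 2) ^ (α - 2) * (r / 2) ^ ((-1 : ℝ) + 2) = r ^ (α - 1) * (1 / 2) ^ (α - 1) := by
      rw [← Real.rpow_add (by positivity), ← Real.mul_rpow hr0.le (by positivity)]
      congr 1 <;> ring
    have p2 : r⁻¹ * (2 * r) ^ (α - 2 + 2) = 2 ^ α * r ^ (α - 1) := by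
      rw [Real.mul_rpow (by positivity) hr0.le, Real.rpow_sub_one hr0.ne']
      rw [show α - 2 + 2 = α by ring]; field_simp
    have p3 : (2 * r) ^ (α - 3 + 2) = 2 ^ (α - 1) * r ^ (α - 1) := by
      rw [Real.mul_rpow (by positivity) hr0.le, show α - 3 + 2 = α - 1 by ring]
    calc _ = vD * ((r / 2) ^ (α - 2) * (r / 2) ^ ((-1 : ℝ) + 2)) +
          vD * 2 * (r⁻¹ * (2 * r) ^ (α - 2 + 2)) / α +
          vD * 2 * (2 * r) ^ (α - 3 + 2) / (1 - α) := by
            rw [show -(2 * r) ^ (α - 3 + 2) / (α - 3 + 2) = (2 * r) ^ (α - 3 + 2) / (1 - α) by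
                rw [show (1 - α) = -(α - 3 + 2) by ring, div_neg, neg_div]]
            generalize (2 * r) ^ (α - 3 + 2) = X3
            rw [show (2 * r) ^ (α - 2 + 2) / (α - 2 + 2) = (2 * r) ^ (α - 2 + 2) / α by
              congr 1; ring]
            generalize (2 * r) ^ (α - 2 + 2) = X2
            generalize (r / 2) ^ (α - 2) = Y1
            rw [show (r / 2) ^ ((-1 : ℝ) + 2) / (-1 + 2) = (r / 2) ^ ((-1 : ℝ) + 2) by
              rw [show ((-1 : ℝ) + 2) = 1 by norm_num]; simp]
            ring
      _ = _ := by
        rw [p1, p2, p3]; ring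

/-! ### Kernels -/

structure Ker (k l : ℂ → ℂ → ℂ) (s : ℂ → ℂ) (σ : ℂ) : Prop where
  s0 : s 0 = 0
  mes : ∀ ζ, Measurable (k ζ)
  ml : ∀ ζ, Measurable (l ζ)
  bk : ∀ ζ ∈ cD, ∀ ω ∈ ball (0 : ℂ) 1, ω ≠ ζ → ‖k ζ ω‖ ≤ ‖ω - ζ‖ ^ (-1 : ℝ)
  bl : ∀ ζ ∈ cD, ∀ ω ∈ ball (0 : ℂ) 1, ω ≠ ζ → ‖l ζ ω‖ ≤ ‖ω - ζ‖ ^ (-2 : ℝ)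
  rem : ∀ ζ ∈ cD, ∀ ζ' ∈ cD, ∀ ω ∈ ball (0 : ℂ) 1, ω ≠ ζ → ω ≠ ζ' →
    ‖k ζ' ω - k ζ ω - s (ζ' - ζ) * l ζ ω‖ ≤ ‖ζ' - ζ‖ ^ 2 * (‖ω - ζ‖ ^ (-2 : ℝ) * ‖ω - ζ'‖⁻¹)
  int : ∀ ζ ∈ cD, ∫ ω in ball (0 : ℂ) 1, k ζ ω = σ * (starRingEnd ℂ) ζ

def Op {n : ℕ} (k : ℂ → ℂ → ℂ) (g : ℂ → Fin n → ℂ) (ζ : ℂ) : Fin n → ℂ :=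
  ∫ ω in ball (0 : ℂ) 1, k ζ ω • g ω

def Dop {n : ℕ} (l : ℂ → ℂ → ℂ) (g : ℂ → Fin n → ℂ) (ζ : ℂ) : Fin n → ℂ :=
  ∫ ω in ball (0 : ℂ) 1, l ζ ω • (g ω - g ζ)

theorem ball_bound {p : ℝ} (hp : -2 < p) (ζ : ℂ) (hζ : ζ ∈ cD) :
    Integrable (fun ω => Lp' 2 p (ω - ζ)) ∧
    (∀ ω ∈ ball (0 : ℂ) 1, ‖ω - ζ‖ ^ p = Lp' 2 p (ω - ζ)) ∧
    ∫ ω, Lp' 2 p (ω - ζ) = vD * (2 ^ (p + 2) / (p + 2)) := by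
  obtain ⟨i, e⟩ := Lp_int (R := 2) (p := p) (by norm_num) hp
  refine ⟨i.comp_sub_right ζ, ?_, ?_⟩
  · intro ω hω
    have h1 : ‖ω‖ < 1 := by simpa using hω
    have h2 : ‖ζ‖ ≤ 1 := by simpa using hζ
    rw [Lp', Set.indicator_of_mem]
    have := norm_sub_le ω ζ
    simp only [Set.mem_Iic]; linarith
  · rw [integral_sub_right_eq_self (Lp' 2 p), e]

theorem HB.continuousOn {E : Type*} [NormedAddCommGroup E] {α : ℝ} (hα : 0 < α) {f : ℂ → E}
    {C : ℝ} (h : HB α f C) : ContinuousOn f cD := by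
  intro x hx
  rw [ContinuousWithinAt, tendsto_iff_norm_sub_tendsto_zero]
  have h1 : Filter.Tendsto (fun y : ℂ => C * ‖y - x‖ ^ α) (nhdsWithin x cD) (nhds 0) := by
    have : Continuous (fun y : ℂ => C * ‖y - x‖ ^ α) :=
      continuous_const.mul ((continuous_id.sub continuous_const).norm.rpow_const
        (fun _ => Or.inr hα.le))
    have h2 := this.tendsto x
    simp only [sub_self, norm_zero, Real.zero_rpow hα.ne', mul_zero] at h2
    exact h2.mono_left nhdsWithin_le_nhds
  refine squeeze_zero' (Filter.Eventually.of_forall fun _ => norm_nonneg _) ?_ h1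
  filter_upwards [self_mem_nhdsWithin] with y hy
  exact h.2 y hy x hx

theorem ball_sub_cD : ball (0 : ℂ) 1 ⊆ cD := ball_subset_closedBall

section
variable {n : ℕ} {α : ℝ} {k l : ℂ → ℂ → ℂ} {s : ℂ → ℂ} {σ : ℂ} {g : ℂ → Fin n → ℂ} {C : ℝ}

theorem HB.aesm (hα : 0 < α) (hg : HB α g C) :
    AEStronglyMeasurable g (volume.restrict (ball (0 : ℂ) 1)) :=
  ((hg.continuousOn hα).mono ball_sub_cD).aestronglyMeasurable measurableSet_ball

theorem Ker.k_int (K : Ker k l s σ) (hα : 0 < α) (hg : HB α g C) {ζ : ℂ} (hζ : ζ ∈ cD) :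
    IntegrableOn (fun ω => k ζ ω • g ω) (ball 0 1) ∧ ‖Op k g ζ‖ ≤ C * (vD * 2) := by
  obtain ⟨i, e, v⟩ := ball_bound (p := -1) (by norm_num) ζ hζ
  have C0 : 0 ≤ C := (norm_nonneg _).trans (hg.1 0 zero_mem_cD)
  have hb : ∀ᵐ ω ∂(volume.restrict (ball (0 : ℂ) 1)),
      ‖k ζ ω • g ω‖ ≤ C * Lp' 2 (-1) (ω - ζ) := by
    filter_upwards [ae_restrict_mem measurableSet_ball,
      ae_restrict_of_ae (Measure.ae_ne volume ζ)] with ω hω h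
    rw [norm_smul, ← e ω hω, mul_comm]
    gcongr
    exacts [hg.1 ω (ball_sub_cD hω), K.bk ζ hζ ω hω h]
  have hi := (i.const_mul C)
  have hm : AEStronglyMeasurable (fun ω => k ζ ω • g ω) (volume.restrict (ball (0 : ℂ) 1)) :=
    (K.mes ζ).aestronglyMeasurable.smul (hg.aesm hα)
  refine ⟨Integrable.mono' hi.integrableOn hm hb, ?_⟩
  calc ‖Op k g ζ‖ ≤ ∫ ω in ball (0 : ℂ) 1, C * Lp' 2 (-1) (ω - ζ) :=
        norm_integral_le_of_norm_le hi.integrableOn hb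
    _ ≤ ∫ ω, C * Lp' 2 (-1) (ω - ζ) :=
        setIntegral_le_integral hi (Filter.Eventually.of_forall fun ω =>
          mul_nonneg C0 (Lp_nonneg _ _ _))
    _ = _ := by rw [integral_const_mul, v]; norm_num

theorem Ker.l_int (K : Ker k l s σ) (hα : 0 < α) (hg : HB α g C) {ζ : ℂ} (hζ : ζ ∈ cD) :
    IntegrableOn (fun ω => l ζ ω • (g ω - g ζ)) (ball 0 1) ∧
      ‖Dop l g ζ‖ ≤ C * (vD * (2 ^ α / α)) := by
  obtain ⟨i, e, v⟩ := ball_bound (p := α - 2) (by linarith) ζ hζ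
  have C0 : 0 ≤ C := (norm_nonneg _).trans (hg.1 0 zero_mem_cD)
  have hb : ∀ᵐ ω ∂(volume.restrict (ball (0 : ℂ) 1)),
      ‖l ζ ω • (g ω - g ζ)‖ ≤ C * Lp' 2 (α - 2) (ω - ζ) := by
    filter_upwards [ae_restrict_mem measurableSet_ball] with ω hω
    rw [norm_smul, ← e ω hω]
    by_cases h : ω = ζ
    · subst h; simp; positivity
    calc _ ≤ ‖ω - ζ‖ ^ (-2 : ℝ) * (C * ‖ω - ζ‖ ^ α) := by
          gcongr
          exacts [K.bl ζ hζ ω hω h, hg.2 ω (ball_sub_cD hω) ζ hζ]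
      _ = C * (‖ω - ζ‖ ^ α * ‖ω - ζ‖ ^ (-2 : ℝ)) := by ring
      _ = _ := by
        rw [← Real.rpow_add (norm_pos_iff.2 (sub_ne_zero.2 h))]; rfl
  have hi := (i.const_mul C)
  have hm : AEStronglyMeasurable (fun ω => l ζ ω • (g ω - g ζ))
      (volume.restrict (ball (0 : ℂ) 1)) :=
    (K.ml ζ).aestronglyMeasurable.smul ((hg.aesm hα).sub aestronglyMeasurable_const)
  refine ⟨Integrable.mono' hi.integrableOn hm hb, ?_⟩
  calc ‖Dop l g ζ‖ ≤ ∫ ω in ball (0 : ℂ) 1, C * Lp' 2 (α - 2) (ω - ζ) :=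
        norm_integral_le_of_norm_le hi.integrableOn hb
    _ ≤ ∫ ω, C * Lp' 2 (α - 2) (ω - ζ) :=
        setIntegral_le_integral hi (Filter.Eventually.of_forall fun ω =>
          mul_nonneg C0 (Lp_nonneg _ _ _))
    _ = _ := by rw [integral_const_mul, v]; norm_num

theorem Ker.jet (K : Ker k l s σ) (hα : α ∈ Set.Ioo (0 : ℝ) 1) :
    ∃ C1 : ℝ, 0 ≤ C1 ∧ ∀ (n : ℕ) (g : ℂ → Fin n → ℂ) (C : ℝ), HB α g C →
      ∀ ζ ∈ cD, ∀ ζ' ∈ cD,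
      ‖Op k g ζ' - Op k g ζ - ((σ * (starRingEnd ℂ) (ζ' - ζ)) • g ζ + s (ζ' - ζ) • Dop l g ζ)‖
        ≤ (C1 * C) * ‖ζ' - ζ‖ ^ (1 + α) := by
  obtain ⟨C1, hC1, hB⟩ := key_bound hα
  refine ⟨C1, hC1, ?_⟩
  intro n g C hg ζ hζ ζ' hζ'
  have C0 : 0 ≤ C := (norm_nonneg _).trans (hg.1 0 zero_mem_cD)
  have hgc : HB α (fun _ : ℂ => g ζ) C := by
    refine ⟨fun _ _ => hg.1 ζ hζ, fun x _ y _ => ?_⟩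
    simp; positivity
  obtain ⟨a1, -⟩ := K.k_int hα.1 hg hζ
  obtain ⟨a2, -⟩ := K.k_int hα.1 hg hζ'
  obtain ⟨b1, -⟩ := K.k_int hα.1 hgc hζ
  obtain ⟨b2, -⟩ := K.k_int hα.1 hgc hζ'
  obtain ⟨d1, -⟩ := K.l_int hα.1 hg hζ
  have hc : ∀ z ∈ cD, ∫ ω in ball (0 : ℂ) 1, k z ω • g ζ = (σ * (starRingEnd ℂ) z) • g ζ := by
    intro z hz
    rw [integral_smul_const, K.int z hz]
  have e : Op k g ζ' - Op k g ζ - ((σ * (starRingEnd ℂ) (ζ' - ζ)) • g ζ + s (ζ' - ζ) • Dop l g ζ)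
      = ∫ ω in ball (0 : ℂ) 1, (k ζ' ω - k ζ ω - s (ζ' - ζ) * l ζ ω) • (g ω - g ζ) := by
    have e1 : ∀ ω, (k ζ' ω - k ζ ω - s (ζ' - ζ) * l ζ ω) • (g ω - g ζ) =
      (k ζ' ω • g ω - k ζ ω • g ω) - (k ζ' ω • g ζ - k ζ ω • g ζ) -
        s (ζ' - ζ) • (l ζ ω • (g ω - g ζ)) := by
      intro ω; module
    simp_rw [e1]
    have a12 : Integrable (fun ω => k ζ' ω • g ω - k ζ ω • g ω)
      (volume.restrict (ball (0 : ℂ) 1)) := a2.sub a1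
    have b12 : Integrable (fun ω => k ζ' ω • g ζ - k ζ ω • g ζ)
      (volume.restrict (ball (0 : ℂ) 1)) := b2.sub b1
    have ab : Integrable (fun ω => k ζ' ω • g ω - k ζ ω • g ω - (k ζ' ω • g ζ - k ζ ω • g ζ))
      (volume.restrict (ball (0 : ℂ) 1)) := a12.sub b12
    have dd : Integrable (fun ω => s (ζ' - ζ) • (l ζ ω • (g ω - g ζ)))
      (volume.restrict (ball (0 : ℂ) 1)) := Integrable.smul (s (ζ' - ζ)) d1
    rw [integral_sub ab dd,
      integral_sub a12 b12, integral_sub a2 a1, integral_sub b2 b1, hc _ hζ,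
      hc _ hζ', integral_smul]
    unfold Op Dop
    rw [map_sub]
    module
  rw [e]
  by_cases hne : ζ = ζ'
  · subst hne
    have : ∫ ω in ball (0 : ℂ) 1, (k ζ ω - k ζ ω - s (ζ - ζ) * l ζ ω) • (g ω - g ζ) = 0 := by
      simp [K.s0]
    rw [this, norm_zero]; positivity
  obtain ⟨B, iB, bB, vB⟩ := hB ζ ζ' hne
  have h2 : ∀ᵐ ω ∂(volume.restrict (ball (0 : ℂ) 1)),
      ‖(k ζ' ω - k ζ ω - s (ζ' - ζ) * l ζ ω) • (g ω - g ζ)‖ ≤ C * ‖ζ' - ζ‖ ^ 2 * B ω := by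
    have n1 : ∀ᵐ ω ∂(volume.restrict (ball (0 : ℂ) 1)), ω ≠ ζ :=
      ae_restrict_of_ae (Measure.ae_ne volume ζ)
    have n2 : ∀ᵐ ω ∂(volume.restrict (ball (0 : ℂ) 1)), ω ≠ ζ' :=
      ae_restrict_of_ae (Measure.ae_ne volume ζ')
    filter_upwards [ae_restrict_mem measurableSet_ball, n1, n2] with ω hω m1 m2
    rw [norm_smul]
    calc _ ≤ (‖ζ' - ζ‖ ^ 2 * (‖ω - ζ‖ ^ (-2 : ℝ) * ‖ω - ζ'‖⁻¹)) * (C * ‖ω - ζ‖ ^ α) := by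
          gcongr
          exacts [K.rem ζ hζ ζ' hζ' ω hω m1 m2, hg.2 ω (ball_sub_cD hω) ζ hζ]
      _ = C * ‖ζ' - ζ‖ ^ 2 * ((‖ω - ζ‖ ^ α * ‖ω - ζ‖ ^ (-2 : ℝ)) * ‖ω - ζ'‖⁻¹) := by ring
      _ = C * ‖ζ' - ζ‖ ^ 2 * (‖ω - ζ‖ ^ (α - 2) * ‖ω - ζ'‖⁻¹) := by
        rw [← Real.rpow_add (norm_pos_iff.2 (sub_ne_zero.2 m1))]; rfl
      _ ≤ _ := by gcongr; exact bB ω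
  have hi := iB.const_mul (C * ‖ζ' - ζ‖ ^ 2)
  have B0 : ∀ ω, 0 ≤ B ω := fun ω => le_trans (by positivity) (bB ω)
  have hr0 : 0 < ‖ζ' - ζ‖ := norm_pos_iff.2 (sub_ne_zero.2 (Ne.symm hne))
  calc _ ≤ ∫ ω in ball (0 : ℂ) 1, C * ‖ζ' - ζ‖ ^ 2 * B ω :=
        norm_integral_le_of_norm_le hi.integrableOn h2
    _ ≤ ∫ ω, C * ‖ζ' - ζ‖ ^ 2 * B ω :=
        setIntegral_le_integral hi (Filter.Eventually.of_forall fun ω =>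
          mul_nonneg (by positivity) (B0 ω))
    _ = C * ‖ζ' - ζ‖ ^ 2 * ∫ ω, B ω := integral_const_mul _ _
    _ ≤ C * ‖ζ' - ζ‖ ^ 2 * (C1 * ‖ζ' - ζ‖ ^ (α - 1)) := by gcongr
    _ = _ := by
      rw [show (1 : ℝ) + α = 2 + (α - 1) by ring, Real.rpow_add hr0, Real.rpow_two]; ring
end

/-! ### Converse of Taylor's theorem -/

structure Jet {V : Type*} [NormedAddCommGroup V] [NormedSpace ℝ V] (α : ℝ) (f : ℂ → V)
    (D : ℂ → ℂ →L[ℝ] V) (C : ℝ) : Prop where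
  b0 : ∀ ζ ∈ cD, ‖f ζ‖ ≤ C
  b1 : ∀ ζ ∈ cD, ‖D ζ‖ ≤ C
  j : ∀ ζ ∈ cD, ∀ ζ' ∈ cD, ‖f ζ' - f ζ - D ζ (ζ' - ζ)‖ ≤ C * ‖ζ' - ζ‖ ^ (1 + α)

section
variable {V : Type*} [NormedAddCommGroup V] [NormedSpace ℝ V] {α : ℝ} {f : ℂ → V}
    {D : ℂ → ℂ →L[ℝ] V} {C : ℝ}

theorem Jet.nonneg (J : Jet α f D C) : 0 ≤ C := (norm_nonneg _).trans (J.b0 0 zero_mem_cD)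

theorem uniqueDiff_cD : UniqueDiffOn ℝ cD :=
  uniqueDiffOn_convex (convex_closedBall _ _) (by
    rw [interior_closedBall _ (by norm_num)]; exact ⟨0, by simp⟩)

theorem Jet.hasFDerivWithinAt (hα : 0 < α) (J : Jet α f D C) {ζ : ℂ} (hζ : ζ ∈ cD) :
    HasFDerivWithinAt f (D ζ) cD ζ := by
  rw [hasFDerivWithinAt_iff_isLittleO]
  have hO : (fun ζ' => f ζ' - f ζ - D ζ (ζ' - ζ)) =O[nhdsWithin ζ cD]
      fun ζ' => ‖ζ' - ζ‖ ^ (1 + α) := by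
    apply Asymptotics.IsBigO.of_bound C
    filter_upwards [self_mem_nhdsWithin] with ζ' h
    rw [Real.norm_of_nonneg (by positivity : (0 : ℝ) ≤ ‖ζ' - ζ‖ ^ (1 + α))]
    exact J.j ζ hζ ζ' h
  refine hO.trans_isLittleO ?_
  rw [← Asymptotics.isLittleO_norm_right, Asymptotics.isLittleO_iff_tendsto']
  · have : Continuous (fun y : ℂ => ‖y - ζ‖ ^ α) :=
      ((continuous_id.sub continuous_const).norm.rpow_const (fun _ => Or.inr hα.le))
    have h2 := this.tendsto ζ
    simp only [sub_self, norm_zero, Real.zero_rpow hα.ne'] at h2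
    refine (h2.mono_left nhdsWithin_le_nhds).congr fun y => ?_
    by_cases h : y = ζ
    · subst h; simp [Real.zero_rpow hα.ne']
    · have := norm_pos_iff.2 (sub_ne_zero.2 h)
      rw [Real.rpow_add this, Real.rpow_one]; field_simp
  · refine Filter.Eventually.of_forall fun y hy => ?_
    rw [hy, Real.zero_rpow (by linarith)]

theorem Jet.fderivWithin (hα : 0 < α) (J : Jet α f D C) {ζ : ℂ} (hζ : ζ ∈ cD) :
    fderivWithin ℝ f cD ζ = D ζ :=
  (J.hasFDerivWithinAt hα hζ).fderivWithin (uniqueDiff_cD ζ hζ)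

theorem Jet.holder (hα : α ∈ Set.Ioo (0 : ℝ) 1) (J : Jet α f D C) {x y : ℂ}
    (hx : x ∈ cD) (hy : y ∈ cD) : ‖D x - D y‖ ≤ (24 * C) * ‖x - y‖ ^ α := by
  have C0 := J.nonneg
  by_cases hne : x = y
  · subst hne; simp; positivity
  set r := ‖x - y‖ with hr
  have hr0 : 0 < r := norm_pos_iff.2 (sub_ne_zero.2 hne)
  have nx : ‖x‖ ≤ 1 := by simpa using hx
  have ny : ‖y‖ ≤ 1 := by simpa using hy
  have hr2 : r ≤ 2 := by have := norm_sub_le x y; linarith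
  have key : ∀ e : ℂ, ‖e‖ ≤ 1 → ‖(D x - D y) (e - y)‖ ≤ 24 * C * r ^ α := by
    intro e he
    set z := y + ((r / 4 : ℝ) : ℂ) * (e - y) with hz
    have hzy : z - y = (r / 4) • (e - y) := by rw [hz]; simp
    have hzD : z ∈ cD := by
      have : z = ((1 - r / 4 : ℝ) : ℂ) * y + ((r / 4 : ℝ) : ℂ) * e := by
        rw [hz]; push_cast; ring
      have h4 : (0 : ℝ) ≤ 1 - r / 4 := by linarith
      have h5 : (0 : ℝ) ≤ r / 4 := by linarith
      have : ‖z‖ ≤ (1 - r / 4) * ‖y‖ + r / 4 * ‖e‖ := by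
        rw [this]; refine (norm_add_le _ _).trans ?_
        rw [norm_mul, norm_mul, Complex.norm_of_nonneg h4, Complex.norm_of_nonneg h5]
      have : ‖z‖ ≤ 1 := by nlinarith
      simpa using this
    have nzy : ‖z - y‖ ≤ r := by
      rw [hzy, norm_smul, Real.norm_of_nonneg (by positivity)]
      have := norm_sub_le e y
      nlinarith
    have nzx : ‖z - x‖ ≤ 2 * r := by
      have : ‖z - x‖ ≤ ‖z - y‖ + ‖x - y‖ := by
        have := norm_sub_le (z - y) (x - y); simpa using this
      linarith
    have j1 := J.j x hx z hzD
    have j2 := J.j y hy z hzD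
    have j3 := J.j x hx y hy
    have e1 : (D x - D y) (z - y) = (f z - f y - D y (z - y)) + (f y - f x - D x (y - x))
        - (f z - f x - D x (z - x)) := by
      simp only [sub_apply, map_sub]; abel
    have p1 : ‖z - x‖ ^ (1 + α) ≤ 4 * (r * r ^ α) := by
      calc ‖z - x‖ ^ (1 + α) ≤ (2 * r) ^ (1 + α) := by
            gcongr; linarith [hα.1]
        _ = 2 ^ (1 + α) * (r * r ^ α) := by
            rw [Real.mul_rpow (by norm_num) hr0.le, Real.rpow_add hr0, Real.rpow_one]
        _ ≤ 2 ^ (2 : ℝ) * (r * r ^ α) := by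
            gcongr
            · norm_num
            · linarith [hα.2]
        _ = _ := by norm_num
    have p2 : ‖z - y‖ ^ (1 + α) ≤ r * r ^ α := by
      calc ‖z - y‖ ^ (1 + α) ≤ r ^ (1 + α) := by gcongr; linarith [hα.1]
        _ = _ := by rw [Real.rpow_add hr0, Real.rpow_one]
    have p3 : ‖y - x‖ ^ (1 + α) ≤ r * r ^ α := by
      rw [norm_sub_rev, ← hr, Real.rpow_add hr0, Real.rpow_one]
    have h6 : ‖(D x - D y) (z - y)‖ ≤ 6 * C * (r * r ^ α) := by
      rw [e1]
      calc _ ≤ _ := norm_sub_le _ _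
        _ ≤ _ := add_le_add_left (norm_add_le _ _) _
        _ ≤ C * (r * r ^ α) + C * (r * r ^ α) + C * (4 * (r * r ^ α)) := by
          gcongr
          · exact j2.trans (by gcongr)
          · exact j3.trans (by gcongr)
          · exact j1.trans (by gcongr)
        _ = _ := by ring
    rw [hzy, map_smul, norm_smul, Real.norm_of_nonneg (by positivity)] at h6
    have : r * ‖(D x - D y) (e - y)‖ ≤ r * (24 * C * r ^ α) := by linarith
    exact le_of_mul_le_mul_left this hr0
  refine ContinuousLinearMap.opNorm_le_of_unit_norm (by positivity) ?_
  intro v hv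
  have k1 := key v hv.le
  have k2 := key (-v) (by simp [hv])
  have e : (D x - D y) v = (1 / 2 : ℝ) • ((D x - D y) (v - y) - (D x - D y) (-v - y)) := by
    rw [← map_sub, ← map_smul]
    congr 1
    rw [Complex.real_smul]; push_cast; ring
  rw [e, norm_smul]
  have := norm_sub_le ((D x - D y) (v - y)) ((D x - D y) (-v - y))
  rw [Real.norm_of_nonneg (by norm_num)]
  linarith

end


/-! ### Polar coordinates -/

theorem polar_ball {f : ℂ → ℂ} (hm : Measurable f) (hf : IntegrableOn f (ball (0 : ℂ) 1)) :
    ∫ ω in ball (0 : ℂ) 1, f ω = ∫ r in Set.Ioo (0 : ℝ) 1,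
      r • ∫ θ in (-Real.pi)..Real.pi, f (circleMap 0 r θ) := by
  have e0 : ∀ p : ℝ × ℝ, Complex.polarCoord.symm p = circleMap 0 p.1 p.2 := by
    intro p
    rw [Complex.polarCoord_symm_apply, circleMap, Complex.exp_mul_I]; simp
  rw [← integral_indicator measurableSet_ball, ← Complex.integral_comp_polarCoord_symm]
  have hmi : Measurable ((ball (0 : ℂ) 1).indicator f) := hm.indicator measurableSet_ball
  have hmc : Measurable (fun p : ℝ × ℝ => circleMap 0 p.1 p.2) := by
    unfold circleMap; fun_prop
  have hI : IntegrableOn (fun p : ℝ × ℝ => p.1 • (ball (0 : ℂ) 1).indicator f (circleMap 0 p.1 p.2))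
      (Set.Ioi (0 : ℝ) ×ˢ Set.Ioo (-Real.pi) Real.pi) (volume.prod volume) := by
    refine ⟨(Measurable.smul measurable_fst (hmi.comp hmc)).aestronglyMeasurable, ?_⟩
    rw [hasFiniteIntegral_iff_enorm]
    have h1 := Complex.lintegral_comp_polarCoord_symm
      (fun z => ‖(ball (0 : ℂ) 1).indicator f z‖ₑ)
    have h2 : ∫⁻ z, ‖(ball (0 : ℂ) 1).indicator f z‖ₑ < ⊤ :=
      (hasFiniteIntegral_iff_enorm).1 ((integrable_indicator_iff measurableSet_ball).2 hf).2
    rw [← h1] at h2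
    refine lt_of_le_of_lt (le_of_eq ?_) h2
    refine setLIntegral_congr_fun (measurableSet_Ioi.prod measurableSet_Ioo) ?_
    intro p hp
    simp only [e0, enorm_smul, smul_eq_mul]
    rw [Real.enorm_of_nonneg (le_of_lt hp.1)]
  simp_rw [e0]
  have hT : polarCoord.target = Set.Ioi (0 : ℝ) ×ˢ Set.Ioo (-Real.pi) Real.pi := rfl
  rw [hT, Measure.volume_eq_prod, setIntegral_prod _ hI]
  have h3 : ∀ r ∈ Set.Ioi (0 : ℝ), ∫ θ in Set.Ioo (-Real.pi) Real.pi,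
      r • (ball (0 : ℂ) 1).indicator f (circleMap 0 r θ) = (Set.Iio (1 : ℝ)).indicator
        (fun r => r • ∫ θ in (-Real.pi)..Real.pi, f (circleMap 0 r θ)) r := by
    intro r hr
    have hr' : (0 : ℝ) < r := hr
    by_cases h : r < 1
    · rw [Set.indicator_of_mem (by simpa using h), integral_smul,
        intervalIntegral.integral_of_le (by linarith [Real.pi_pos]), integral_Ioc_eq_integral_Ioo]
      congr 1
      refine setIntegral_congr_fun measurableSet_Ioo fun θ _ => ?_
      rw [Set.indicator_of_mem]
      simp [abs_of_pos hr', h]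
    · rw [Set.indicator_of_notMem (by simpa using h)]
      have : ∀ θ, (ball (0 : ℂ) 1).indicator f (circleMap 0 r θ) = 0 := by
        intro θ
        rw [Set.indicator_of_notMem]
        simpa [abs_of_pos hr'] using h
      simp [this]
  rw [setIntegral_congr_fun measurableSet_Ioi h3, setIntegral_indicator measurableSet_Iio]
  rfl

theorem ang_eq (f : ℂ → ℂ) (r : ℝ) :
    ∫ θ in (-Real.pi)..Real.pi, f (circleMap 0 r θ) =
      ((2 * Real.pi : ℝ) : ℂ) * Real.circleAverage f 0 r := by
  have hp : Function.Periodic (fun θ => f (circleMap 0 r θ)) (2 * Real.pi) := by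
    intro θ; simp only [periodic_circleMap (0 : ℂ) r θ]
  have := hp.intervalIntegral_add_eq (-Real.pi) 0
  rw [show -Real.pi + 2 * Real.pi = Real.pi by ring, zero_add] at this
  rw [this, Real.circleAverage_def, Complex.real_smul, ← mul_assoc, ← Complex.ofReal_mul,
    mul_inv_cancel₀ (by positivity)]
  simp

theorem int_r (a : ℝ) (ha : 0 ≤ a) (ha1 : a ≤ 1) :
    ∫ r in Set.Ioo (0 : ℝ) 1, (Set.Iio a).indicator (fun r : ℝ => (r : ℂ)) r = (a ^ 2 / 2 : ℝ) := by
  rw [setIntegral_indicator measurableSet_Iio]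
  have : Set.Ioo (0 : ℝ) 1 ∩ Set.Iio a = Set.Ioo 0 a := by
    ext x; simp; intro _ _; linarith
  rw [this, ← integral_Ioc_eq_integral_Ioo, ← intervalIntegral.integral_of_le ha,
    intervalIntegral.integral_ofReal, integral_id]
  simp

theorem k1_integrable {w : ℂ} (hw : w ∈ cD) :
    IntegrableOn (fun ω => (ω - w)⁻¹) (ball (0 : ℂ) 1) := by
  obtain ⟨i, e, -⟩ := ball_bound (p := -1) (by norm_num) w hw
  refine Integrable.mono' i.integrableOn (by fun_prop) ?_
  filter_upwards [ae_restrict_mem measurableSet_ball] with ω hω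
  rw [← e ω hω, norm_inv, Real.rpow_neg_one]

theorem conj_interval (f : ℝ → ℂ) (a b : ℝ) :
    (starRingEnd ℂ) (∫ x in a..b, f x) = ∫ x in a..b, (starRingEnd ℂ) (f x) := by
  simp only [intervalIntegral, map_sub, integral_conj]

theorem k1_int {w : ℂ} (hw : w ∈ cD) :
    ∫ ω in ball (0 : ℂ) 1, (ω - w)⁻¹ = (-Real.pi : ℂ) * (starRingEnd ℂ) w := by
  have hw1 : ‖w‖ ≤ 1 := by simpa using hw
  rw [polar_ball (by fun_prop) (k1_integrable hw)]
  have h : ∀ᵐ r ∂(volume.restrict (Set.Ioo (0 : ℝ) 1)),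
      r • ∫ θ in (-Real.pi)..Real.pi, (circleMap 0 r θ - w)⁻¹ =
      (-(2 * Real.pi) / w : ℂ) * (Set.Iio ‖w‖).indicator (fun r : ℝ => (r : ℂ)) r := by
    filter_upwards [ae_restrict_mem measurableSet_Ioo,
      ae_restrict_of_ae (Measure.ae_ne volume ‖w‖)] with r hr hne
    have hr0 := hr.1
    rw [ang_eq (fun z => (z - w)⁻¹) r]
    rcases lt_or_gt_of_ne hne with hlt | hgt
    · rw [Set.indicator_of_mem (by simpa using hlt)]
      have : Real.circleAverage (fun z => (z - w)⁻¹) 0 r = (0 - w)⁻¹ := by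
        have hd : DifferentiableOn ℂ (fun z : ℂ => (z - w)⁻¹) (closedBall 0 |r|) := by
          intro z hz
          have : z - w ≠ 0 := by
            intro h
            have : z = w := sub_eq_zero.1 h
            subst this
            rw [abs_of_pos hr0] at hz
            have : ‖z‖ ≤ r := by simpa using hz
            linarith
          fun_prop (disch := assumption)
        refine DiffContOnCl.circleAverage (f := fun z : ℂ => (z - w)⁻¹) ?_
        exact (hd.mono closure_ball_subset_closedBall).diffContOnCl
      rw [this]
      have : w ≠ 0 := by
        intro h; subst h; simp at hlt; linarith
      rw [Complex.real_smul]; push_cast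
      rw [zero_sub]; field_simp
    · rw [Set.indicator_of_notMem (by simpa using hgt.le)]
      have : Real.circleAverage (fun z => (z - w)⁻¹) 0 r = 0 := by
        have hd : DifferentiableOn ℂ (fun z : ℂ => z / (r ^ 2 - (starRingEnd ℂ) w * z))
            (closedBall 0 |r|) := by
          intro z hz
          have : (r ^ 2 - (starRingEnd ℂ) w * z) ≠ 0 := by
            intro h
            have h2 : ((r : ℂ) ^ 2) = (starRingEnd ℂ) w * z := sub_eq_zero.1 h
            have h3 := congrArg norm h2
            rw [abs_of_pos hr0] at hz
            have h4 : ‖z‖ ≤ r := by simpa using hz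
            simp [abs_of_pos hr0] at h3
            nlinarith [norm_nonneg w]
          fun_prop (disch := assumption)
        have h1 := DiffContOnCl.circleAverage
          (f := fun z : ℂ => z / (r ^ 2 - (starRingEnd ℂ) w * z)) (c := 0) (R := r)
          (hd.mono closure_ball_subset_closedBall).diffContOnCl
        simp only [zero_div] at h1
        have h2 : Real.circleAverage (fun z => (z - w)⁻¹) 0 r = (starRingEnd ℂ)
          (Real.circleAverage (fun z : ℂ => z / (r ^ 2 - (starRingEnd ℂ) w * z)) 0 r) := by
          rw [Real.circleAverage_def, Real.circleAverage_def, Complex.real_smul, Complex.real_smul,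
            map_mul, Complex.conj_ofReal, conj_interval]
          congr 1
          apply intervalIntegral.integral_congr
          intro θ _
          have hz : circleMap 0 r θ * (starRingEnd ℂ) (circleMap 0 r θ) = (r : ℂ) ^ 2 := by
            rw [Complex.mul_conj, Complex.normSq_eq_norm_sq]; simp
          have hz0 : (starRingEnd ℂ) (circleMap 0 r θ) ≠ 0 := by
            simp [hr0.ne']
          simp only [map_div₀, map_sub, map_mul, map_pow, Complex.conj_ofReal, Complex.conj_conj]
          rw [← hz, ← sub_mul, div_mul_cancel_right₀ hz0]
        rw [h2, h1, map_zero]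
      rw [this]; simp
  rw [integral_congr_ae h, integral_const_mul, int_r _ (norm_nonneg _) hw1]
  by_cases h0 : w = 0
  · simp [h0]
  have : (starRingEnd ℂ) w = ((‖w‖ ^ 2 : ℝ) : ℂ) / w := by
    rw [← Complex.normSq_eq_norm_sq, ← Complex.mul_conj]; field_simp
  rw [this]; push_cast; field_simp

theorem k2_ne {ζ ω : ℂ} (hζ : ζ ∈ cD) (hω : ω ∈ ball (0 : ℂ) 1) :
    1 - (starRingEnd ℂ) ζ * ω ≠ 0 := by
  intro h
  have h1 : (1 : ℂ) = (starRingEnd ℂ) ζ * ω := sub_eq_zero.1 h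
  have h2 := congrArg norm h1
  have h3 : ‖ζ‖ ≤ 1 := by simpa using hζ
  have h4 : ‖ω‖ < 1 := by simpa using hω
  simp at h2
  nlinarith [norm_nonneg ω]

theorem k2_ge {ζ ω : ℂ} (hζ : ζ ∈ cD) (hω : ω ∈ ball (0 : ℂ) 1) :
    ‖ω - ζ‖ ≤ ‖1 - (starRingEnd ℂ) ζ * ω‖ := by
  have h3 : ‖ζ‖ ≤ 1 := by simpa using hζ
  have h4 : ‖ω‖ < 1 := by simpa using hω
  apply le_of_sq_le_sq _ (norm_nonneg _)
  rw [Complex.sq_norm, Complex.sq_norm]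
  have h5 : Complex.normSq ζ ≤ 1 := by
    rw [Complex.normSq_eq_norm_sq]; nlinarith [norm_nonneg ζ]
  have h6 : Complex.normSq ω ≤ 1 := by
    rw [Complex.normSq_eq_norm_sq]; nlinarith [norm_nonneg ω]
  simp only [Complex.normSq_apply] at *
  simp
  nlinarith [mul_nonneg (sub_nonneg.2 h5) (sub_nonneg.2 h6)]

def kk1 (ζ ω : ℂ) : ℂ := (ω - ζ)⁻¹
def ll1 (ζ ω : ℂ) : ℂ := ((ω - ζ) ^ 2)⁻¹
def kk2 (ζ ω : ℂ) : ℂ := (starRingEnd ℂ) ζ / (1 - (starRingEnd ℂ) ζ * ω)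
def ll2 (ζ ω : ℂ) : ℂ := ((1 - (starRingEnd ℂ) ζ * ω) ^ 2)⁻¹

theorem ker1 : Ker kk1 ll1 (fun h => h) (-Real.pi) where
  s0 := rfl
  mes ζ := by unfold kk1; fun_prop
  ml ζ := by unfold ll1; fun_prop
  bk ζ _ ω _ _ := by rw [kk1, norm_inv, Real.rpow_neg_one]
  bl ζ _ ω _ _ := by
    rw [ll1, norm_inv, norm_pow, Real.rpow_neg (norm_nonneg _), Real.rpow_two]
  rem ζ _ ζ' _ ω _ h h' := by
    have a : ω - ζ ≠ 0 := sub_ne_zero.2 h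
    have b : ω - ζ' ≠ 0 := sub_ne_zero.2 h'
    have : kk1 ζ' ω - kk1 ζ ω - (ζ' - ζ) * ll1 ζ ω =
        (ζ' - ζ) ^ 2 * (((ω - ζ) ^ 2)⁻¹ * (ω - ζ')⁻¹) := by
      unfold kk1 ll1; field_simp; ring
    rw [this, norm_mul, norm_mul, norm_inv, norm_inv, norm_pow, norm_pow,
      Real.rpow_neg (norm_nonneg _), Real.rpow_two]
  int ζ hζ := k1_int hζ

theorem kk2_integrable {w : ℂ} (hw : w ∈ cD) :
    IntegrableOn (kk2 w) (ball (0 : ℂ) 1) := by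
  obtain ⟨i, e, -⟩ := ball_bound (p := -1) (by norm_num) w hw
  have hm : Measurable (kk2 w) := by unfold kk2; fun_prop
  refine Integrable.mono' i.integrableOn hm.aestronglyMeasurable ?_
  filter_upwards [ae_restrict_mem measurableSet_ball,
      ae_restrict_of_ae (Measure.ae_ne volume w)] with ω hω h
  have h3 : ‖w‖ ≤ 1 := by simpa using hw
  have a : 0 < ‖ω - w‖ := norm_pos_iff.2 (sub_ne_zero.2 h)
  rw [← e ω hω, kk2, norm_div, Real.rpow_neg_one, RCLike.norm_conj, div_eq_mul_inv]
  calc _ ≤ 1 * ‖ω - w‖⁻¹ := by gcongr; exact k2_ge hw hω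
    _ = _ := one_mul _

theorem ker2 : Ker kk2 ll2 (fun h => (starRingEnd ℂ) h) Real.pi where
  s0 := by simp
  mes ζ := by unfold kk2; fun_prop
  ml ζ := by unfold ll2; fun_prop
  bk ζ hζ ω hω h := by
    have h3 : ‖ζ‖ ≤ 1 := by simpa using hζ
    have a : 0 < ‖ω - ζ‖ := norm_pos_iff.2 (sub_ne_zero.2 h)
    rw [kk2, norm_div, Real.rpow_neg_one, RCLike.norm_conj, div_eq_mul_inv]
    calc _ ≤ 1 * ‖ω - ζ‖⁻¹ := by gcongr; exact k2_ge hζ hω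
      _ = _ := one_mul _
  bl ζ hζ ω hω h := by
    have a : 0 < ‖ω - ζ‖ := norm_pos_iff.2 (sub_ne_zero.2 h)
    rw [ll2, norm_inv, norm_pow, Real.rpow_neg (norm_nonneg _), Real.rpow_two]
    gcongr; exact k2_ge hζ hω
  rem ζ hζ ζ' hζ' ω hω h h' := by
    have h4 : ‖ω‖ < 1 := by simpa using hω
    have a := k2_ne hζ hω
    have b := k2_ne hζ' hω
    have a1 : 0 < ‖ω - ζ‖ := norm_pos_iff.2 (sub_ne_zero.2 h)
    have a2 : 0 < ‖ω - ζ'‖ := norm_pos_iff.2 (sub_ne_zero.2 h')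
    have : kk2 ζ' ω - kk2 ζ ω - (starRingEnd ℂ) (ζ' - ζ) * ll2 ζ ω =
        (starRingEnd ℂ) (ζ' - ζ) ^ 2 * (((1 - (starRingEnd ℂ) ζ * ω) ^ 2)⁻¹ *
          (1 - (starRingEnd ℂ) ζ' * ω)⁻¹) * ω := by
      unfold kk2 ll2; rw [map_sub]
      generalize (starRingEnd ℂ) ζ = x at *
      generalize (starRingEnd ℂ) ζ' = y at *
      rw [div_sub_div _ _ b a]
      field_simp; ring
    rw [this, norm_mul, norm_mul, norm_mul, norm_inv, norm_inv, norm_pow, norm_pow,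
      Real.rpow_neg (norm_nonneg _), Real.rpow_two, RCLike.norm_conj]
    calc _ ≤ ‖ζ' - ζ‖ ^ 2 * ((‖ω - ζ‖ ^ 2)⁻¹ * ‖ω - ζ'‖⁻¹) * 1 := by
          gcongr
          exacts [k2_ge hζ hω, k2_ge hζ' hω]
      _ = _ := mul_one _
  int ζ hζ := by
    rw [polar_ball (by unfold kk2; fun_prop) (kk2_integrable hζ)]
    have h : ∀ r ∈ Set.Ioo (0 : ℝ) 1,
        r • ∫ θ in (-Real.pi)..Real.pi, kk2 ζ (circleMap 0 r θ) =
        ((2 * Real.pi) * (starRingEnd ℂ) ζ : ℂ) *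
          (Set.Iio (1 : ℝ)).indicator (fun r : ℝ => (r : ℂ)) r := by
      intro r hr
      rw [ang_eq (kk2 ζ) r, Set.indicator_of_mem (by simpa using hr.2)]
      have hd : DifferentiableOn ℂ (kk2 ζ) (closedBall 0 |r|) := by
        intro z hz
        have : 1 - (starRingEnd ℂ) ζ * z ≠ 0 := by
          apply k2_ne hζ
          rw [abs_of_pos hr.1] at hz
          have : ‖z‖ ≤ r := by simpa using hz
          simp; linarith [hr.2]
        unfold kk2
        fun_prop (disch := assumption)
      rw [DiffContOnCl.circleAverage (f := kk2 ζ) (c := 0) (R := r)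
          (hd.mono closure_ball_subset_closedBall).diffContOnCl, Complex.real_smul]
      simp [kk2]; ring
    rw [setIntegral_congr_fun measurableSet_Ioo h, integral_const_mul, int_r 1 (by norm_num) le_rfl]
    push_cast; ring


/-! ### Regularity of the Schwarz integral -/

theorem schwarz_rep (φ : ℂ → ℝ)
    (h1 : ContDiff ℝ 1 (fun θ : ℝ => φ (Complex.exp (θ * Complex.I)))) {ζ : ℂ}
    (hζ : ζ ∈ ball (0 : ℂ) 1) :
    schwarz φ ζ = schwarz φ 0 + (1 / Real.pi : ℂ) * ∫ r in Set.Ioo (0 : ℝ) 1,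
      r • ∫ θ in (-Real.pi)..Real.pi,
        (ζ * r * Complex.exp (-(θ * Complex.I))) / (1 - ζ * r * Complex.exp (-(θ * Complex.I))) *
        (2 * (φ (Complex.exp (θ * Complex.I)) : ℂ) -
          Complex.I * ((deriv (fun θ : ℝ => φ (Complex.exp (θ * Complex.I))) θ : ℝ) : ℂ)) := by
  have hz : ‖ζ‖ < 1 := by simpa using hζ
  set p : ℝ → ℂ := fun θ => (φ (Complex.exp (θ * Complex.I)) : ℂ) with hp
  set p' : ℝ → ℂ := fun θ => ((deriv (fun θ : ℝ => φ (Complex.exp (θ * Complex.I))) θ : ℝ) : ℂ) with hp'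
  have hpd : ∀ θ, HasDerivAt p (p' θ) θ := fun θ =>
    ((h1.differentiable (by simp)).differentiableAt.hasDerivAt).ofReal_comp
  have hpc : Continuous p := Complex.continuous_ofReal.comp h1.continuous
  have hpc' : Continuous p' := Complex.continuous_ofReal.comp (h1.continuous_deriv (by simp))
  have hexp : ∀ θ : ℝ, Complex.exp ((θ + 2 * Real.pi : ℝ) * Complex.I) = Complex.exp (θ * Complex.I) := by
    intro θ
    have := Complex.exp_periodic (θ * Complex.I)
    rw [← this]; congr 1; push_cast; ring
  have hne : ∀ s : ℝ, s ∈ Set.Icc (0 : ℝ) 1 → ∀ θ : ℝ,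
      1 - ζ * s * Complex.exp (-(θ * Complex.I)) ≠ 0 := by
    intro s hs θ h
    have h2 : (1 : ℂ) = ζ * s * Complex.exp (-(θ * Complex.I)) := sub_eq_zero.1 h
    have h3 := congrArg norm h2
    rw [norm_mul, norm_mul, ← neg_mul, ← Complex.ofReal_neg, Complex.norm_exp_ofReal_mul_I,
      Complex.norm_of_nonneg hs.1] at h3
    simp at h3
    nlinarith [norm_nonneg ζ, hs.1, hs.2]
  -- the integrand
  set G : ℝ → ℝ → ℂ := fun s θ =>
    (2 * s * ((ζ * s * Complex.exp (-(θ * Complex.I))) / (1 - ζ * s * Complex.exp (-(θ * Complex.I))))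
      + s * ((ζ * s * Complex.exp (-(θ * Complex.I))) /
        (1 - ζ * s * Complex.exp (-(θ * Complex.I))) ^ 2)) * p θ with hG
  have hGc : ContinuousOn G.uncurry (Set.Icc (0 : ℝ) 1 ×ˢ Set.univ) := by
    have : ∀ q ∈ (Set.Icc (0 : ℝ) 1 ×ˢ (Set.univ : Set ℝ)),
      1 - ζ * q.1 * Complex.exp (-(q.2 * Complex.I)) ≠ 0 := fun q hq => hne q.1 hq.1 q.2
    have h2 : ∀ q ∈ (Set.Icc (0 : ℝ) 1 ×ˢ (Set.univ : Set ℝ)),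
      (1 - ζ * q.1 * Complex.exp (-(q.2 * Complex.I))) ^ 2 ≠ 0 := fun q hq => pow_ne_zero 2 (this q hq)
    have hc2 : Continuous (fun q : ℝ × ℝ => p q.2) := hpc.comp continuous_snd
    have e : G.uncurry = fun q : ℝ × ℝ => (2 * q.1 * ((ζ * q.1 * Complex.exp (-(q.2 * Complex.I))) / (1 - ζ * q.1 * Complex.exp (-(q.2 * Complex.I))))
      + q.1 * ((ζ * q.1 * Complex.exp (-(q.2 * Complex.I))) /
        (1 - ζ * q.1 * Complex.exp (-(q.2 * Complex.I))) ^ 2)) * p q.2 := by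
      ext q; rfl
    rw [e]
    refine ContinuousOn.mul (ContinuousOn.add ?_ ?_) hc2.continuousOn
    · exact ContinuousOn.mul (by fun_prop) (ContinuousOn.div (by fun_prop) (by fun_prop) this)
    · exact ContinuousOn.mul (by fun_prop) (ContinuousOn.div (by fun_prop) (by fun_prop) h2)
  have swap : ∫ s in (0 : ℝ)..1, ∫ θ in (-Real.pi)..Real.pi, G s θ =
      ∫ θ in (-Real.pi)..Real.pi, ∫ s in (0 : ℝ)..1, G s θ := by
    apply intervalIntegral_intervalIntegral_swap
    have : IntegrableOn G.uncurry (Set.Icc (0 : ℝ) 1 ×ˢ Set.Icc (-Real.pi) Real.pi) :=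
      (hGc.mono (Set.prod_mono le_rfl (Set.subset_univ _))).integrableOn_compact
        (isCompact_Icc.prod isCompact_Icc)
    refine this.mono_set (Set.prod_mono ?_ ?_)
    · rw [Set.uIoc_of_le (by norm_num)]; exact Set.Ioc_subset_Icc_self
    · rw [Set.uIoc_of_le (by linarith [Real.pi_pos])]; exact Set.Ioc_subset_Icc_self
  have I1 : ∀ θ, ∫ s in (0 : ℝ)..1, G s θ =
      (ζ * Complex.exp (-(θ * Complex.I))) / (1 - ζ * Complex.exp (-(θ * Complex.I))) * p θ := by
    intro θ
    have hd : ∀ s ∈ Set.uIcc (0 : ℝ) 1, HasDerivAt (fun s : ℝ => ((s : ℂ) ^ 2 * ((ζ * s * Complex.exp (-(θ * Complex.I))) /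
      (1 - ζ * s * Complex.exp (-(θ * Complex.I))))) * p θ) (G s θ) s := by
      intro s hs
      rw [Set.uIcc_of_le (by norm_num)] at hs
      have hn := hne s hs θ
      have d0 : HasDerivAt (fun s : ℝ => (s : ℂ)) 1 s := Complex.ofRealCLM.hasDerivAt
      have d1 : HasDerivAt (fun s : ℝ => ζ * s * Complex.exp (-(θ * Complex.I)))
        (ζ * 1 * Complex.exp (-(θ * Complex.I))) s := (d0.const_mul ζ).mul_const _
      have d2 := ((d0.pow 2).mul (d1.div (d1.const_sub 1) hn)).mul_const (p θ)
      refine d2.congr_deriv ?_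
      simp only [hG, Pi.pow_apply, Pi.div_apply]
      push_cast
      field_simp
      ring
    rw [intervalIntegral.integral_eq_sub_of_hasDerivAt hd]
    · simp
    · apply ContinuousOn.intervalIntegrable
      rw [Set.uIcc_of_le (by norm_num)]
      exact hGc.comp (f := fun s : ℝ => (s, θ)) (by fun_prop) (fun s hs => ⟨hs, trivial⟩)
  have I2 : ∀ s ∈ Set.Ioo (0 : ℝ) 1, ∫ θ in (-Real.pi)..Real.pi, G s θ =
      s • ∫ θ in (-Real.pi)..Real.pi,
        (ζ * s * Complex.exp (-(θ * Complex.I))) / (1 - ζ * s * Complex.exp (-(θ * Complex.I))) *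
        (2 * p θ - Complex.I * p' θ) := by
    intro s hs
    have hs' : s ∈ Set.Icc (0 : ℝ) 1 := Set.Ioo_subset_Icc_self hs
    set u : ℝ → ℂ := fun θ => (ζ * s * Complex.exp (-(θ * Complex.I))) / (1 - ζ * s * Complex.exp (-(θ * Complex.I))) with hu
    set u' : ℝ → ℂ := fun θ => -Complex.I * ((ζ * s * Complex.exp (-(θ * Complex.I))) / (1 - ζ * s * Complex.exp (-(θ * Complex.I))) ^ 2) with hu'
    have huc : Continuous u := Continuous.div (by fun_prop) (by fun_prop) (fun θ => hne s hs' θ)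
    have huc' : Continuous u' := Continuous.mul (by fun_prop)
      (Continuous.div (by fun_prop) (by fun_prop) (fun θ => pow_ne_zero 2 (hne s hs' θ)))
    have hud : ∀ θ, HasDerivAt u (u' θ) θ := by
      intro θ
      have hn := hne s hs' θ
      have d0 : HasDerivAt (fun s : ℝ => (s : ℂ)) 1 θ := Complex.ofRealCLM.hasDerivAt
      have d1 := ((d0.mul_const Complex.I).neg.cexp).const_mul (ζ * s)
      have d2 := (d1.div (d1.const_sub 1) hn)
      refine d2.congr_deriv ?_
      simp only [hu']
      have hn2 : (1 - ζ * s * Complex.exp ((-fun y : ℝ => (y : ℂ) * Complex.I) θ)) ≠ 0 := hn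
      simp only [Pi.neg_apply] at hn2 ⊢
      field_simp
      ring
    have parts := intervalIntegral.integral_deriv_mul_eq_sub (a := -Real.pi) (b := Real.pi)
      (fun θ _ => hud θ) (fun θ _ => hpd θ) (huc'.intervalIntegrable _ _)
      (hpc'.intervalIntegrable _ _)
    have hexpm : Complex.exp (-((Real.pi : ℝ) * Complex.I)) = Complex.exp (-((-Real.pi : ℝ) * Complex.I)) := by
      rw [Complex.exp_neg, Complex.exp_pi_mul_I]; push_cast
      rw [neg_mul, neg_neg, Complex.exp_pi_mul_I]; norm_num
    have b1 : u Real.pi = u (-Real.pi) := by simp only [hu, hexpm]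
    have b2 : p Real.pi = p (-Real.pi) := by
      have := hexp (-Real.pi)
      rw [show -Real.pi + 2 * Real.pi = Real.pi by ring] at this
      simp only [hp, this]
    rw [b1, b2, sub_self] at parts
    rw [← intervalIntegral.integral_smul]
    have e : ∀ θ, G s θ = s • (u θ * (2 * p θ - Complex.I * p' θ)) +
        (s * Complex.I) * (u' θ * p θ + u θ * p' θ) := by
      intro θ
      simp only [hG, hu, hu', Complex.real_smul]
      linear_combination ((s : ℂ) * ((ζ * s * Complex.exp (-(θ * Complex.I))) / (1 - ζ * s * Complex.exp (-(θ * Complex.I))) ^ 2) * p θ) * Complex.I_sq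
    simp_rw [e]
    rw [intervalIntegral.integral_add, intervalIntegral.integral_const_mul, parts, mul_zero, add_zero]
    · exact (Continuous.intervalIntegrable (by fun_prop) _ _)
    · exact (Continuous.intervalIntegrable (by fun_prop) _ _)
  have hS : ∀ w ∈ ball (0 : ℂ) 1, schwarz φ w = (1 / (2 * Real.pi) : ℂ) *
      ∫ θ in (-Real.pi)..Real.pi, (p θ + 2 * ((w * Complex.exp (-(θ * Complex.I))) / (1 - w * Complex.exp (-(θ * Complex.I))) * p θ)) := by
    intro w hw
    unfold schwarz
    congr 1
    have hP : Function.Periodic (fun θ : ℝ => ((Complex.exp (θ * Complex.I) + w) / (Complex.exp (θ * Complex.I) - w)) *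
      (φ (Complex.exp (θ * Complex.I)) : ℂ)) (2 * Real.pi) := by
      intro θ; simp only [hexp]
    have := hP.intervalIntegral_add_eq (-Real.pi) 0
    rw [show -Real.pi + 2 * Real.pi = Real.pi by ring, zero_add] at this
    rw [← this]
    apply intervalIntegral.integral_congr
    intro θ _
    have hw' : ‖w‖ < 1 := by simpa using hw
    have n1 : Complex.exp (θ * Complex.I) - w ≠ 0 := by
      intro h
      have h2 := congrArg norm (sub_eq_zero.1 h)
      rw [Complex.norm_exp_ofReal_mul_I] at h2; linarith
    have n0 := Complex.exp_ne_zero (θ * Complex.I)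
    simp only [hp, Complex.exp_neg]
    have n2 : 1 - w * (Complex.exp (θ * Complex.I))⁻¹ ≠ 0 := by
      intro h; apply n1
      field_simp at h; simpa using h
    field_simp
    ring
  have hcont : Continuous fun θ : ℝ => (ζ * Complex.exp (-(θ * Complex.I))) / (1 - ζ * Complex.exp (-(θ * Complex.I))) * p θ := by
    refine Continuous.mul (Continuous.div (by fun_prop) (by fun_prop) fun θ => ?_) hpc
    have := hne 1 (by simp) θ
    simpa using this
  have hc2 : IntervalIntegrable (fun θ : ℝ => 2 * ((ζ * Complex.exp (-(θ * Complex.I))) / (1 - ζ * Complex.exp (-(θ * Complex.I))) * p θ)) volume (-Real.pi) Real.pi :=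
    Continuous.intervalIntegrable (by exact continuous_const.mul hcont) _ _
  rw [hS ζ hζ, hS 0 (by simp), intervalIntegral.integral_add (hpc.intervalIntegrable _ _)
    hc2, intervalIntegral.integral_const_mul]
  rw [← setIntegral_congr_fun measurableSet_Ioo I2, ← integral_Ioc_eq_integral_Ioo,
    ← intervalIntegral.integral_of_le (by norm_num), swap]
  simp_rw [I1]
  generalize (∫ θ : ℝ in (-Real.pi)..Real.pi, (ζ * Complex.exp (-(θ * Complex.I))) /
    (1 - ζ * Complex.exp (-(θ * Complex.I))) * p θ) = J
  simp
  field_simp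

theorem rpow_le_four {x α : ℝ} (hα : α ∈ Set.Ioo (0 : ℝ) 1) (h0 : 0 ≤ x) (h : x ≤ 4) :
    x ≤ 4 * x ^ α := by
  rcases h0.eq_or_lt with h0 | h0
  · subst h0; positivity
  calc x = x ^ (1 - α) * x ^ α := by
        rw [← Real.rpow_add h0]; simp
    _ ≤ 4 ^ (1 : ℝ) * x ^ α := by
        gcongr
        calc x ^ (1 - α) ≤ 4 ^ (1 - α) := by gcongr; linarith [hα.2]
          _ ≤ 4 ^ (1 : ℝ) := by
            apply Real.rpow_le_rpow_of_exponent_le (by norm_num); linarith [hα.1]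
    _ = _ := by simp

def mm (ψ : ℝ → ℂ) (ω : ℂ) : ℂ := (starRingEnd ℂ) ω * ψ (Complex.arg ω)

theorem mm_HB {α : ℝ} (hα : α ∈ Set.Ioo (0 : ℝ) 1) {ψ : ℝ → ℂ}
    (hper : Function.Periodic ψ (2 * Real.pi)) {B L : ℝ} (hB : ∀ θ, ‖ψ θ‖ ≤ B) (hL0 : 0 ≤ L)
    (hL : ∀ θ θ', |θ - θ'| ≤ 4 → ‖ψ θ - ψ θ'‖ ≤ L * |θ - θ'| ^ α) :
    HB α (mm ψ) (4 * B + 4 * L) := by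
  have B0 : 0 ≤ B := (norm_nonneg _).trans (hB 0)
  constructor
  · intro x hx
    have hx' : ‖x‖ ≤ 1 := by simpa using hx
    rw [mm, norm_mul, RCLike.norm_conj]
    have := hB x.arg
    nlinarith [norm_nonneg x, norm_nonneg (ψ x.arg)]
  have main : ∀ x ∈ cD, ∀ y ∈ cD, ‖x‖ ≤ ‖y‖ → ‖mm ψ y - mm ψ x‖ ≤ (4 * B + 4 * L) * ‖y - x‖ ^ α := by
    intro x hx y hy hxy
    have hx' : ‖x‖ ≤ 1 := by simpa using hx
    have hy' : ‖y‖ ≤ 1 := by simpa using hy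
    have hd4 : ‖y - x‖ ≤ 4 := by have := norm_sub_le y x; linarith
    have h1 : ‖y - x‖ ≤ 4 * ‖y - x‖ ^ α := rpow_le_four hα (norm_nonneg _) hd4
    have e : mm ψ y - mm ψ x = (starRingEnd ℂ) (y - x) * ψ y.arg +
      (starRingEnd ℂ) x * (ψ y.arg - ψ x.arg) := by
      unfold mm; rw [map_sub]; ring
    have h2 : ‖(starRingEnd ℂ) x * (ψ y.arg - ψ x.arg)‖ ≤ 4 * L * ‖y - x‖ ^ α := by
      rw [norm_mul, RCLike.norm_conj]
      by_cases h0 : x = 0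
      · subst h0; simp; positivity
      have x0 : 0 < ‖x‖ := norm_pos_iff.2 h0
      have hy0 : y ≠ 0 := by intro h; subst h; simp at hxy; exact h0 hxy
      have y0 : 0 < ‖y‖ := norm_pos_iff.2 hy0
      set Δ := Complex.arg (y / x) with hΔ
      have a1 : |Δ| ≤ Real.pi / 2 * ‖y / ‖y‖ - x / ‖x‖‖ := by
        have := Complex.angle_le_mul_norm_sub (x := y / ‖y‖) (y := x / ‖x‖)
          (by simp [y0.ne']) (by simp [x0.ne'])
        rw [Complex.angle_eq_abs_arg (by simp [hy0]) (by simp [h0])] at this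
        have e : (y / ‖y‖) / (x / ‖x‖) = ((‖x‖ / ‖y‖ : ℝ) : ℂ) * (y / x) := by
          push_cast
          have : (‖x‖ : ℂ) ≠ 0 := by exact_mod_cast x0.ne'
          have : (‖y‖ : ℂ) ≠ 0 := by exact_mod_cast y0.ne'
          field_simp
        rw [e, Complex.arg_real_mul _ (by positivity)] at this
        exact this
      have a2 : ‖x‖ * ‖y / ‖y‖ - x / ‖x‖‖ ≤ 2 * ‖y - x‖ := by
        have cx : (‖x‖ : ℂ) ≠ 0 := by exact_mod_cast x0.ne'
        have cy : (‖y‖ : ℂ) ≠ 0 := by exact_mod_cast y0.ne'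
        have e : ((‖x‖ : ℝ) : ℂ) * (y / ‖y‖ - x / ‖x‖) = (y - x) - (((‖y‖ - ‖x‖ : ℝ)) : ℂ) * (y / ‖y‖) := by
          push_cast; field_simp; ring
        have : ‖x‖ * ‖y / ‖y‖ - x / ‖x‖‖ = ‖((‖x‖ : ℝ) : ℂ) * (y / ‖y‖ - x / ‖x‖)‖ := by
          rw [norm_mul, Complex.norm_of_nonneg (norm_nonneg x)]
        rw [this, e]
        refine (norm_sub_le _ _).trans ?_
        rw [norm_mul, Complex.norm_of_nonneg (sub_nonneg.2 hxy)]
        have : ‖y / (‖y‖ : ℂ)‖ = 1 := by simp [y0.ne']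
        rw [this]
        have := norm_sub_norm_le y x
        linarith
      have a3 : ‖x‖ * |Δ| ≤ 4 * ‖y - x‖ := by
        have : ‖x‖ * |Δ| ≤ Real.pi / 2 * (‖x‖ * ‖y / ‖y‖ - x / ‖x‖‖) := by
          calc _ ≤ ‖x‖ * (Real.pi / 2 * ‖y / ‖y‖ - x / ‖x‖‖) := by gcongr
            _ = _ := by ring
        nlinarith [Real.pi_le_four, Real.pi_pos, norm_nonneg (y - x)]
      have a4 : ψ y.arg = ψ (x.arg + Δ) := by
        have h := Complex.arg_div_coe_angle hy0 h0
        rw [← Real.Angle.coe_sub, Real.Angle.angle_eq_iff_two_pi_dvd_sub] at h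
        obtain ⟨k, hk⟩ := h
        have : x.arg + Δ = y.arg + k * (2 * Real.pi) := by rw [hΔ]; linarith
        rw [this, (hper.int_mul k) y.arg]
      rw [a4]
      have a5 : ‖ψ (x.arg + Δ) - ψ x.arg‖ ≤ L * |Δ| ^ α := by
        have := hL (x.arg + Δ) x.arg (by
          rw [add_sub_cancel_left]; exact (Complex.abs_arg_le_pi _).trans Real.pi_le_four)
        rwa [add_sub_cancel_left] at this
      calc _ ≤ ‖x‖ * (L * |Δ| ^ α) := by gcongr
        _ ≤ ‖x‖ ^ α * (L * |Δ| ^ α) := by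
          gcongr
          calc ‖x‖ = ‖x‖ ^ (1 : ℝ) := by simp
            _ ≤ ‖x‖ ^ α := Real.rpow_le_rpow_of_exponent_ge x0 hx' hα.2.le
        _ = L * (‖x‖ * |Δ|) ^ α := by rw [Real.mul_rpow x0.le (abs_nonneg _)]; ring
        _ ≤ L * (4 * ‖y - x‖) ^ α := by gcongr; exact hα.1.le
        _ = L * (4 ^ α * ‖y - x‖ ^ α) := by rw [Real.mul_rpow (by norm_num) (norm_nonneg _)]
        _ ≤ L * (4 ^ (1 : ℝ) * ‖y - x‖ ^ α) := by
          gcongr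
          · norm_num
          · exact hα.2.le
        _ = _ := by simp; ring
    rw [e]
    calc _ ≤ _ := norm_add_le _ _
      _ ≤ ‖y - x‖ * B + 4 * L * ‖y - x‖ ^ α := by
        gcongr
        rw [norm_mul, RCLike.norm_conj]
        gcongr; exact hB _
      _ ≤ (4 * ‖y - x‖ ^ α) * B + 4 * L * ‖y - x‖ ^ α := by gcongr
      _ = _ := by ring
  intro x hx y hy
  rcases le_total ‖x‖ ‖y‖ with h | h
  · rw [norm_sub_rev, norm_sub_rev x y]; exact main x hx y hy h
  · exact main y hy x hx h


/-! ### Jets of the integral operators and of `F` -/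

section
variable {V W : Type*} [NormedAddCommGroup V] [NormedSpace ℝ V] [NormedAddCommGroup W]
  [NormedSpace ℝ W] {α : ℝ} {f f' : ℂ → V} {D D' : ℂ → ℂ →L[ℝ] V} {C C' : ℝ}

theorem Jet.mono (J : Jet α f D C) (h : C ≤ C') : Jet α f D C' where
  b0 ζ hζ := (J.b0 ζ hζ).trans h
  b1 ζ hζ := (J.b1 ζ hζ).trans h
  j ζ hζ ζ' hζ' := (J.j ζ hζ ζ' hζ').trans (by gcongr)

theorem Jet.add (J : Jet α f D C) (J' : Jet α f' D' C') :
    Jet α (fun ζ => f ζ + f' ζ) (fun ζ => D ζ + D' ζ) (C + C') where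
  b0 ζ hζ := (norm_add_le _ _).trans (add_le_add (J.b0 ζ hζ) (J'.b0 ζ hζ))
  b1 ζ hζ := (norm_add_le _ _).trans (add_le_add (J.b1 ζ hζ) (J'.b1 ζ hζ))
  j ζ hζ ζ' hζ' := by
    have e : f ζ' + f' ζ' - (f ζ + f' ζ) - (D ζ + D' ζ) (ζ' - ζ) =
      (f ζ' - f ζ - D ζ (ζ' - ζ)) + (f' ζ' - f' ζ - D' ζ (ζ' - ζ)) := by
      rw [_root_.add_apply]; abel
    rw [e, add_mul]
    exact (norm_add_le _ _).trans (add_le_add (J.j ζ hζ ζ' hζ') (J'.j ζ hζ ζ' hζ'))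

theorem Jet.clm (J : Jet α f D C) (L : V →L[ℝ] W) :
    Jet α (fun ζ => L (f ζ)) (fun ζ => L ∘L D ζ) (‖L‖ * C) where
  b0 ζ hζ := (L.le_opNorm _).trans (by gcongr; exact J.b0 ζ hζ)
  b1 ζ hζ := (L.opNorm_comp_le _).trans (by gcongr; exact J.b1 ζ hζ)
  j ζ hζ ζ' hζ' := by
    have e : L (f ζ') - L (f ζ) - (L ∘L D ζ) (ζ' - ζ) = L (f ζ' - f ζ - D ζ (ζ' - ζ)) := by
      simp
    rw [e, mul_assoc]
    exact (L.le_opNorm _).trans (by gcongr; exact J.j ζ hζ ζ' hζ')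

theorem Jet.const (v : V) : Jet α (fun _ => v) (fun _ => 0) ‖v‖ where
  b0 ζ hζ := le_rfl
  b1 ζ hζ := by simp
  j ζ hζ ζ' hζ' := by simp; positivity

theorem Jet.congr (J : Jet α f D C) (h : ∀ ζ ∈ cD, f' ζ = f ζ) : Jet α f' D C where
  b0 ζ hζ := by rw [h ζ hζ]; exact J.b0 ζ hζ
  b1 ζ hζ := J.b1 ζ hζ
  j ζ hζ ζ' hζ' := by rw [h ζ hζ, h ζ' hζ']; exact J.j ζ hζ ζ' hζ'

theorem Jet.continuousOn (hα : 0 < α) (J : Jet α f D C) : ContinuousOn f cD :=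
  fun _ hζ => (J.hasFDerivWithinAt hα hζ).continuousWithinAt
end

def conjL : ℂ →L[ℝ] ℂ := (Complex.conjCLE : ℂ →L[ℝ] ℂ)
theorem conjL_apply (z : ℂ) : conjL z = (starRingEnd ℂ) z := rfl

def DD {n : ℕ} (σ : ℂ) (sL : ℂ →L[ℝ] ℂ) (l : ℂ → ℂ → ℂ) (g : ℂ → Fin n → ℂ) (ζ : ℂ) :
    ℂ →L[ℝ] (Fin n → ℂ) :=
  (σ • conjL).smulRight (g ζ) + sL.smulRight (Dop l g ζ)

theorem Ker.Jet {α : ℝ} (hα : α ∈ Set.Ioo (0 : ℝ) 1) {k l : ℂ → ℂ → ℂ} {s : ℂ → ℂ} {σ : ℂ}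
    (K : Ker k l s σ) (sL : ℂ →L[ℝ] ℂ) (hs : ∀ h, sL h = s h) (hs1 : ∀ h, ‖sL h‖ ≤ ‖h‖) :
    ∃ C1 : ℝ, 0 ≤ C1 ∧ ∀ (n : ℕ) (g : ℂ → Fin n → ℂ) (C : ℝ), HB α g C →
      Jet α (Op k g) (DD σ sL l g) (C1 * C) := by
  obtain ⟨C1, hC1, hj⟩ := K.jet hα
  have v0 := vD_nonneg
  have a0 := hα.1
  refine ⟨C1 + vD * 2 + (‖σ‖ + vD * (2 ^ α / α)), by positivity, ?_⟩
  intro n g C hg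
  have C0 : 0 ≤ C := hg.nonneg
  have n1 : 0 ≤ C1 * C := by positivity
  have n2 : 0 ≤ C * (vD * 2) := by positivity
  have n3 : 0 ≤ ‖σ‖ * C := by positivity
  have n4 : 0 ≤ C * (vD * (2 ^ α / α)) := by positivity
  constructor
  · intro ζ hζ
    have := (K.k_int hα.1 hg hζ).2
    linarith
  · intro ζ hζ
    apply ContinuousLinearMap.opNorm_le_bound _ (by positivity)
    intro h
    have e : DD σ sL l g ζ h = (σ * (starRingEnd ℂ) h) • g ζ + sL h • Dop l g ζ := rfl
    rw [e]
    have := (K.l_int hα.1 hg hζ).2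
    have h2 := hg.1 ζ hζ
    calc _ ≤ ‖(σ * (starRingEnd ℂ) h) • g ζ‖ + ‖sL h • Dop l g ζ‖ := norm_add_le _ _
      _ ≤ (‖σ‖ * ‖h‖) * C + ‖h‖ * (C * (vD * (2 ^ α / α))) := by
        rw [norm_smul, norm_smul, norm_mul, RCLike.norm_conj]
        gcongr
        exact hs1 h
      _ = (‖σ‖ * C + C * (vD * (2 ^ α / α))) * ‖h‖ := by ring
      _ ≤ _ := by gcongr; linarith
  · intro ζ hζ ζ' hζ'
    have e : DD σ sL l g ζ (ζ' - ζ) =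
      (σ * (starRingEnd ℂ) (ζ' - ζ)) • g ζ + s (ζ' - ζ) • Dop l g ζ := by
      rw [← hs]; rfl
    rw [e]
    refine (hj n g C hg ζ hζ ζ' hζ').trans ?_
    have n5 : 0 ≤ vD * (2 ^ α / α) := by positivity
    gcongr
    linarith [norm_nonneg σ]

theorem F_jet {α : ℝ} (hα : α ∈ Set.Ioo (0 : ℝ) 1) (φ : ℂ → ℝ)
    (h1 : ContDiff ℝ 1 (fun θ : ℝ => φ (Complex.exp (θ * Complex.I))))
    (h2 : HolderOn α (deriv fun θ : ℝ => φ (Complex.exp (θ * Complex.I))) Set.univ)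
    (F : ℂ → ℂ) (hFc : ContinuousOn F (closedBall (0 : ℂ) 1))
    (hF : ∀ ζ ∈ ball (0 : ℂ) 1, F ζ = schwarz φ ζ) :
    ∃ D C, Jet α F D C := by
  set q : ℝ → ℝ := fun θ : ℝ => φ (Complex.exp (θ * Complex.I)) with hq
  have hexp : ∀ θ : ℝ, Complex.exp ((θ + 2 * Real.pi : ℝ) * Complex.I) = Complex.exp (θ * Complex.I) := by
    intro θ
    have := Complex.exp_periodic (θ * Complex.I)
    rw [← this]; congr 1; push_cast; ring
  have qper : Function.Periodic q (2 * Real.pi) := fun θ => by simp only [hq, hexp]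
  have q'per : Function.Periodic (deriv q) (2 * Real.pi) := by
    intro θ
    rw [← deriv_comp_add_const]
    congr 1
    funext x; exact qper x
  have qc : Continuous q := h1.continuous
  have q'c : Continuous (deriv q) := h1.continuous_deriv (by simp)
  have bdd : ∀ f : ℝ → ℝ, Continuous f → Function.Periodic f (2 * Real.pi) → ∃ B, ∀ θ, |f θ| ≤ B := by
    intro f hf hper
    obtain ⟨B, hB⟩ := isCompact_Icc.exists_bound_of_continuousOn (s := Set.Icc (0 : ℝ) (0 + 2 * Real.pi)) hf.continuousOn
    refine ⟨B, fun θ => ?_⟩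
    obtain ⟨y, hy, e⟩ := hper.exists_mem_Ico₀ Real.two_pi_pos θ
    rw [e]; exact hB y ⟨hy.1, by linarith [hy.2]⟩
  obtain ⟨B0, hB0⟩ := bdd q qc qper
  obtain ⟨B1, hB1⟩ := bdd _ q'c q'per
  obtain ⟨K, hK⟩ := h2
  have hB10 : 0 ≤ B1 := (abs_nonneg _).trans (hB1 0)
  set ψ : ℝ → ℂ := fun θ => 2 * (q θ : ℂ) - Complex.I * ((deriv q θ : ℝ) : ℂ) with hψ
  have ψc : Continuous ψ := by
    have a := Complex.continuous_ofReal.comp qc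
    have b := Complex.continuous_ofReal.comp q'c
    exact (continuous_const.mul a).sub (continuous_const.mul b)
  have ψper : Function.Periodic ψ (2 * Real.pi) := fun θ => by
    simp only [hψ, qper θ, q'per θ]
  have ψB : ∀ θ, ‖ψ θ‖ ≤ 2 * B0 + B1 := by
    intro θ
    refine (norm_sub_le _ _).trans ?_
    simp only [norm_mul, Complex.norm_real, Complex.norm_I, one_mul, Complex.norm_ofNat, Real.norm_eq_abs]
    linarith [hB0 θ, hB1 θ]
  have ψL : ∀ θ θ', |θ - θ'| ≤ 4 → ‖ψ θ - ψ θ'‖ ≤ (8 * B1 + |K|) * |θ - θ'| ^ α := by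
    intro θ θ' h
    have e : ψ θ - ψ θ' = 2 * ((q θ - q θ' : ℝ) : ℂ) - Complex.I * ((deriv q θ - deriv q θ' : ℝ) : ℂ) := by
      simp only [hψ]; push_cast; ring
    rw [e]
    refine (norm_sub_le _ _).trans ?_
    simp only [norm_mul, Complex.norm_real, Complex.norm_I, one_mul, Complex.norm_ofNat]
    have l1 : ‖q θ - q θ'‖ ≤ B1 * ‖θ - θ'‖ :=
      convex_univ.norm_image_sub_le_of_norm_deriv_le (f := q)
        (fun x _ => (h1.differentiable (by simp)).differentiableAt) (fun x _ => hB1 x) trivial trivial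
    have l2 := hK θ trivial θ' trivial
    have l3 := rpow_le_four hα (abs_nonneg (θ - θ')) h
    rw [Real.norm_eq_abs (θ - θ')] at l1 l2
    have l4 : K * |θ - θ'| ^ α ≤ |K| * |θ - θ'| ^ α := by gcongr; exact le_abs_self K
    have l5 : B1 * |θ - θ'| ≤ B1 * (4 * |θ - θ'| ^ α) := by gcongr
    linarith
  have hm := mm_HB hα ψper ψB (by positivity) ψL
  set C := 4 * (2 * B0 + B1) + 4 * (8 * B1 + |K|)
  set g : ℂ → Fin 1 → ℂ := fun ω _ => (starRingEnd ℂ) (mm ψ ω) with hg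
  have hgB : HB α g C := by
    refine ⟨fun x hx => ?_, fun x hx y hy => ?_⟩
    · rw [pi_norm_le_iff_of_nonneg hm.nonneg]
      intro _; rw [hg, RCLike.norm_conj]; exact hm.1 x hx
    · have h0 := (norm_nonneg _).trans (hm.2 x hx y hy)
      rw [pi_norm_le_iff_of_nonneg h0]
      intro _; simp only [hg, Pi.sub_apply]; rw [← map_sub, RCLike.norm_conj]; exact hm.2 x hx y hy
  obtain ⟨C1, -, hJ⟩ := ker2.Jet hα conjL (fun h => rfl) (fun h => by rw [conjL_apply, RCLike.norm_conj])
  have J1 := hJ 1 g C hgB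
  let L : (Fin 1 → ℂ) →L[ℝ] ℂ := (1 / Real.pi : ℂ) • (conjL ∘L ContinuousLinearMap.proj 0)
  have J2 := (Jet.const (α := α) (F 0)).add (J1.clm L)
  have key : ∀ ζ ∈ ball (0 : ℂ) 1, F ζ = F 0 + L (Op kk2 g ζ) := by
    intro ζ hζ
    rw [hF ζ hζ, hF 0 (by simp), schwarz_rep φ h1 hζ]
    congr 1
    have hi := (ker2.k_int hα.1 hgB (ball_sub_cD hζ)).1
    have e0 : Op kk2 g ζ 0 = ∫ ω in ball (0 : ℂ) 1, kk2 ζ ω * (starRingEnd ℂ) (mm ψ ω) := by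
      have := ((ContinuousLinearMap.proj (R := ℝ) (φ := fun _ : Fin 1 => ℂ) 0).integral_comp_comm hi)
      rw [Op]
      exact this.symm
    have e1 : L (Op kk2 g ζ) = (1 / Real.pi : ℂ) * (starRingEnd ℂ) (Op kk2 g ζ 0) := rfl
    have hi2 : IntegrableOn (fun ω => kk2 ζ ω * (starRingEnd ℂ) (mm ψ ω)) (ball (0 : ℂ) 1) :=
      (ContinuousLinearMap.proj (R := ℝ) (φ := fun _ : Fin 1 => ℂ) 0).integrable_comp hi
    have hmm : Measurable (mm ψ) := by
      unfold mm
      exact (Complex.continuous_conj.measurable).mul (ψc.measurable.comp Complex.measurable_arg)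
    have hmes : Measurable (fun ω => kk2 ζ ω * (starRingEnd ℂ) (mm ψ ω)) :=
      (ker2.mes ζ).mul (Complex.continuous_conj.measurable.comp hmm)
    rw [e1, e0, polar_ball hmes hi2, ← integral_conj]
    congr 1
    apply setIntegral_congr_fun measurableSet_Ioo
    intro r hr
    simp only [Complex.real_smul, map_mul, Complex.conj_ofReal]
    rw [conj_interval]
    congr 1
    apply intervalIntegral.integral_congr_ae
    filter_upwards with θ hθ
    rw [Set.uIoc_of_le (by linarith [Real.pi_pos])] at hθ
    have e2 : circleMap 0 r θ = r * Complex.exp (θ * Complex.I) := by simp [circleMap]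
    have e3 : Complex.arg (circleMap 0 r θ) = θ := by
      rw [e2, Complex.exp_mul_I]; exact Complex.arg_mul_cos_add_sin_mul_I hr.1 hθ
    have e4 : (starRingEnd ℂ) (circleMap 0 r θ) = r * Complex.exp (-(θ * Complex.I)) := by
      rw [e2, map_mul, Complex.conj_ofReal, ← Complex.exp_conj]; simp
    rw [map_mul, Complex.conj_conj, mm, e3, e4, kk2]
    simp only [map_div₀, map_sub, map_mul, map_one, Complex.conj_conj, e4]
    simp only [hψ, hq]
    ring
  refine ⟨_, _, J2.congr ?_⟩
  have hc := J2.continuousOn hα.1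
  have : Set.EqOn F (fun ζ => F 0 + L (Op kk2 g ζ)) (closure (ball (0 : ℂ) 1)) := by
    have hcl : closure (ball (0 : ℂ) 1) = closedBall (0 : ℂ) 1 := closure_ball _ (by norm_num)
    refine Set.EqOn.of_subset_closure (s := ball (0 : ℂ) 1) key ?_ ?_ subset_closure le_rfl
    · rw [hcl]; exact hFc
    · rw [hcl]; exact hc
  rw [closure_ball _ (by norm_num)] at this
  exact this


/-! ### The space `X` and the operator `Kfun` -/

section
variable {n : ℕ} {α : ℝ} {f f' : ℂ → Fin n → ℂ} {D : ℂ → ℂ →L[ℝ] (Fin n → ℂ)} {C : ℝ}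

theorem Jet.memX (hα : α ∈ Set.Ioo (0 : ℝ) 1) (J : Jet α f D C) :
    MemX α f ∧ normX α f ≤ 26 * C := by
  have C0 := J.nonneg
  have hd : ∀ x ∈ cD, _root_.fderivWithin ℝ f cD x = D x := fun x hx => J.fderivWithin hα.1 hx
  have hH : ∀ x ∈ cD, ∀ y ∈ cD, ‖_root_.fderivWithin ℝ f cD x - _root_.fderivWithin ℝ f cD y‖ ≤
      (24 * C) * ‖x - y‖ ^ α := by
    intro x hx y hy
    rw [hd x hx, hd y hy]; exact J.holder hα hx hy
  have hB : HB α (_root_.fderivWithin ℝ f cD) (24 * C) := by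
    refine ⟨fun x hx => ?_, hH⟩
    rw [hd x hx]; linarith [J.b1 x hx]
  refine ⟨⟨?_, 24 * C, hH⟩, ?_⟩
  · rw [show (1 : WithTop ℕ∞) = 0 + 1 from rfl, contDiffOn_succ_iff_fderivWithin uniqueDiff_cD]
    refine ⟨fun x hx => (J.hasFDerivWithinAt hα.1 hx).differentiableWithinAt, by simp, ?_⟩
    rw [contDiffOn_zero]
    exact hB.continuousOn hα.1
  · have e1 : (⨆ ζ : closedBall (0 : ℂ) 1, ‖f (ζ : ℂ)‖) ≤ C :=
      Real.iSup_le (fun ζ => J.b0 ζ.1 ζ.2) C0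
    have e2 : (⨆ ζ : closedBall (0 : ℂ) 1, ‖_root_.fderivWithin ℝ f (closedBall (0 : ℂ) 1) (ζ : ℂ)‖) ≤ C :=
      Real.iSup_le (fun ζ => by rw [hd ζ.1 ζ.2]; exact J.b1 ζ.1 ζ.2) C0
    have e3 : (⨆ p : {p : ℂ × ℂ // p.1 ∈ closedBall (0 : ℂ) 1 ∧ p.2 ∈ closedBall (0 : ℂ) 1 ∧ p.1 ≠ p.2},
      ‖_root_.fderivWithin ℝ f (closedBall (0 : ℂ) 1) p.1.1 -
      _root_.fderivWithin ℝ f (closedBall (0 : ℂ) 1) p.1.2‖ / ‖p.1.1 - p.1.2‖ ^ α) ≤ 24 * C := by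
      refine Real.iSup_le (fun p => ?_) (by positivity)
      rw [div_le_iff₀ (rpow_dist_pos p.2.2.2 α)]
      exact hH _ p.2.1 _ p.2.2.1
    unfold normX
    linarith

theorem memX_bounds (hf : MemX α f) :
    (∀ x ∈ cD, ‖f x‖ ≤ normX α f) ∧ (∀ x ∈ cD, ‖fderivWithin ℝ f cD x‖ ≤ normX α f) ∧
    ∀ x ∈ cD, ∀ y ∈ cD, ‖fderivWithin ℝ f cD x - fderivWithin ℝ f cD y‖ ≤ normX α f * ‖x - y‖ ^ α := by
  obtain ⟨h1, K, hK⟩ := hf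
  have hc : IsCompact cD := isCompact_closedBall _ _
  obtain ⟨B0, hB0⟩ := hc.exists_bound_of_continuousOn h1.continuousOn
  obtain ⟨B1, hB1⟩ := hc.exists_bound_of_continuousOn
    (h1.continuousOn_fderivWithin uniqueDiff_cD (by simp))
  have b0 : BddAbove (Set.range fun ζ : closedBall (0 : ℂ) 1 => ‖f (ζ : ℂ)‖) :=
    ⟨B0, by rintro _ ⟨ζ, rfl⟩; exact hB0 _ ζ.2⟩
  have b1 : BddAbove (Set.range fun ζ : closedBall (0 : ℂ) 1 => ‖fderivWithin ℝ f (closedBall (0 : ℂ) 1) (ζ : ℂ)‖) :=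
    ⟨B1, by rintro _ ⟨ζ, rfl⟩; exact hB1 _ ζ.2⟩
  have b2 : BddAbove (Set.range fun p : {p : ℂ × ℂ // p.1 ∈ closedBall (0 : ℂ) 1 ∧ p.2 ∈ closedBall (0 : ℂ) 1 ∧ p.1 ≠ p.2} =>
      ‖fderivWithin ℝ f (closedBall (0 : ℂ) 1) p.1.1 -
      fderivWithin ℝ f (closedBall (0 : ℂ) 1) p.1.2‖ / ‖p.1.1 - p.1.2‖ ^ α) :=
    ⟨K, by
      rintro _ ⟨p, rfl⟩
      simp only
      rw [div_le_iff₀ (rpow_dist_pos p.2.2.2 α)]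
      exact hK _ p.2.1 _ p.2.2.1⟩
  have n0 : 0 ≤ (⨆ ζ : closedBall (0 : ℂ) 1, ‖f (ζ : ℂ)‖) := Real.iSup_nonneg fun _ => norm_nonneg _
  have n1 : 0 ≤ (⨆ ζ : closedBall (0 : ℂ) 1, ‖fderivWithin ℝ f (closedBall (0 : ℂ) 1) (ζ : ℂ)‖) :=
    Real.iSup_nonneg fun _ => norm_nonneg _
  have n2 : 0 ≤ (⨆ p : {p : ℂ × ℂ // p.1 ∈ closedBall (0 : ℂ) 1 ∧ p.2 ∈ closedBall (0 : ℂ) 1 ∧ p.1 ≠ p.2},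
      ‖fderivWithin ℝ f (closedBall (0 : ℂ) 1) p.1.1 -
      fderivWithin ℝ f (closedBall (0 : ℂ) 1) p.1.2‖ / ‖p.1.1 - p.1.2‖ ^ α) :=
    Real.iSup_nonneg fun _ => by positivity
  refine ⟨fun x hx => ?_, fun x hx => ?_, fun x hx y hy => ?_⟩
  · have := le_ciSup b0 ⟨x, hx⟩
    unfold normX; simp only at this; linarith
  · have := le_ciSup b1 ⟨x, hx⟩
    unfold normX; simp only at this; linarith
  · by_cases h : x = y
    · subst h; simp only [sub_self, norm_zero]
      unfold normX; positivity
    · rw [← div_le_iff₀ (rpow_dist_pos h α)]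
      have := le_ciSup b2 ⟨(x, y), hx, hy, h⟩
      unfold normX; simp only at this; linarith

/-- the Wirtinger derivative as a linear functional of the derivative -/
def wdL (n : ℕ) (T : ℂ →L[ℝ] (Fin n → ℂ)) : Fin n → ℂ :=
  (1 / 2 : ℂ) • (T 1 - Complex.I • T Complex.I)

theorem wdL_norm (T : ℂ →L[ℝ] (Fin n → ℂ)) : ‖wdL n T‖ ≤ ‖T‖ := by
  unfold wdL
  rw [norm_smul]
  have h1 := T.le_opNorm 1
  have h2 := T.le_opNorm Complex.I
  have h3 := norm_sub_le (T 1) (Complex.I • T Complex.I)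
  rw [norm_smul] at h3
  simp at h1 h2 h3 ⊢
  linarith

theorem wdL_add (T T' : ℂ →L[ℝ] (Fin n → ℂ)) : wdL n (T + T') = wdL n T + wdL n T' := by
  unfold wdL
  simp only [_root_.add_apply, smul_add, smul_sub]
  abel

theorem wdL_smul (c : ℝ) (T : ℂ →L[ℝ] (Fin n → ℂ)) : wdL n (c • T) = c • wdL n T := by
  unfold wdL
  simp only [_root_.smul_apply, smul_sub]
  rw [smul_comm (1 / 2 : ℂ) c, smul_comm Complex.I c, smul_comm (1 / 2 : ℂ) c]

theorem wdL_sub (T T' : ℂ →L[ℝ] (Fin n → ℂ)) : wdL n (T - T') = wdL n T - wdL n T' := by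
  unfold wdL
  simp only [_root_.sub_apply, smul_sub]
  abel

theorem wdzD_eq (f : ℂ → Fin n → ℂ) (x : ℂ) : wdzD f x = wdL n (fderivWithin ℝ f cD x) := rfl

theorem MemX.diff (hf : MemX α f) {x : ℂ} (hx : x ∈ cD) : DifferentiableWithinAt ℝ f cD x :=
  (hf.1.differentiableOn (by simp)) x hx

theorem MemX.HB (hα : α ∈ Set.Ioo (0 : ℝ) 1) (hf : MemX α f) : HB α f (4 * normX α f) := by
  obtain ⟨b0, b1, b2⟩ := memX_bounds hf
  have N0 : 0 ≤ normX α f := (norm_nonneg _).trans (b0 0 zero_mem_cD)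
  refine ⟨fun x hx => by linarith [b0 x hx], fun x hx y hy => ?_⟩
  have h1 : ‖f x - f y‖ ≤ normX α f * ‖x - y‖ :=
    (convex_closedBall (0 : ℂ) 1).norm_image_sub_le_of_norm_fderivWithin_le (𝕜 := ℝ)
      (fun z hz => hf.diff hz) b1 hy hx
  have nx : ‖x‖ ≤ 1 := by simpa using hx
  have ny : ‖y‖ ≤ 1 := by simpa using hy
  have h2 := rpow_le_four hα (norm_nonneg (x - y)) (by have := norm_sub_le x y; linarith)
  nlinarith

theorem MemX.HB' (hf : MemX α f) : _root_.HB α (wdzD f) (4 * normX α f) := by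
  obtain ⟨b0, b1, b2⟩ := memX_bounds hf
  have N0 : 0 ≤ normX α f := (norm_nonneg _).trans (b0 0 zero_mem_cD)
  refine ⟨fun x hx => ?_, fun x hx y hy => ?_⟩
  · have := wdL_norm (fderivWithin ℝ f cD x)
    rw [wdzD_eq]; linarith [b1 x hx]
  · rw [wdzD_eq, wdzD_eq, ← wdL_sub]
    refine (wdL_norm _).trans ((b2 x hx y hy).trans ?_)
    gcongr; linarith

theorem MemX.add (hf : MemX α f) (hf' : MemX α f') : MemX α (fun x => f x + f' x) := by
  refine ⟨hf.1.add hf'.1, ?_⟩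
  obtain ⟨-, K, hK⟩ := id hf
  obtain ⟨-, K', hK'⟩ := id hf'
  refine ⟨K + K', fun x hx y hy => ?_⟩
  have e : ∀ x ∈ cD, fderivWithin ℝ (fun x => f x + f' x) cD x =
      fderivWithin ℝ f cD x + fderivWithin ℝ f' cD x := fun x hx =>
    fderivWithin_fun_add (uniqueDiff_cD x hx) (hf.diff hx) (hf'.diff hx)
  rw [e x hx, e y hy, add_mul, add_sub_add_comm]
  exact (norm_add_le _ _).trans (add_le_add (hK x hx y hy) (hK' x hx y hy))

theorem MemX.smul (hf : MemX α f) (c : ℝ) : MemX α (fun x => c • f x) := by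
  refine ⟨hf.1.const_smul c, ?_⟩
  obtain ⟨-, K, hK⟩ := id hf
  refine ⟨|c| * K, fun x hx y hy => ?_⟩
  have e : ∀ x ∈ cD, fderivWithin ℝ (fun x => c • f x) cD x =
      c • fderivWithin ℝ f cD x := fun x hx =>
    fderivWithin_fun_const_smul (uniqueDiff_cD x hx) (hf.diff hx) c
  have e2 : ∀ T T' : ℂ →L[ℝ] (Fin n → ℂ), ‖c • T - c • T'‖ = |c| * ‖T - T'‖ := by
    intro T T'
    have : c • T - c • T' = c • (T - T') := (smul_sub c T T').symm
    rw [this, norm_smul, Real.norm_eq_abs]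
  rw [e x hx, e y hy, e2, mul_assoc]
  gcongr
  exact hK x hx y hy

theorem MemX.congr (hf : MemX α f) (h : ∀ x ∈ cD, f' x = f x) : MemX α f' := by
  refine ⟨hf.1.congr h, ?_⟩
  obtain ⟨-, K, hK⟩ := id hf
  refine ⟨K, fun x hx y hy => ?_⟩
  have e : ∀ x ∈ cD, fderivWithin ℝ f' cD x = fderivWithin ℝ f cD x := fun x hx =>
    fderivWithin_congr h (h x hx)
  rw [e x hx, e y hy]; exact hK x hx y hy

theorem wdzD_add (hf : MemX α f) (hf' : MemX α f') {x : ℂ} (hx : x ∈ cD) :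
    wdzD (fun x => f x + f' x) x = wdzD f x + wdzD f' x := by
  rw [wdzD_eq, fderivWithin_fun_add (uniqueDiff_cD x hx) (hf.diff hx) (hf'.diff hx), wdL_add]; rfl

theorem wdzD_smul (hf : MemX α f) (c : ℝ) {x : ℂ} (hx : x ∈ cD) :
    wdzD (fun x => c • f x) x = c • wdzD f x := by
  rw [wdzD_eq, fderivWithin_fun_const_smul (uniqueDiff_cD x hx) (hf.diff hx), wdL_smul]; rfl

theorem wdzD_congr (h : ∀ x ∈ cD, f' x = f x) {x : ℂ} (hx : x ∈ cD) : wdzD f' x = wdzD f x := by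
  rw [wdzD_eq, fderivWithin_congr h (h x hx)]; rfl
end

section
variable {n : ℕ}

def conjVL (n : ℕ) : (Fin n → ℂ) →L[ℝ] (Fin n → ℂ) :=
  ContinuousLinearMap.pi fun i => conjL ∘L ContinuousLinearMap.proj i

theorem conjVL_apply (v : Fin n → ℂ) : conjVL n v = conjVec v := rfl

def LL1 (n : ℕ) : (Fin n → ℂ) →L[ℝ] (Fin n → ℂ) :=
  (-(1 / Real.pi : ℂ)) • ContinuousLinearMap.id ℝ (Fin n → ℂ)
def LL2 (n : ℕ) : (Fin n → ℂ) →L[ℝ] (Fin n → ℂ) :=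
  -(conjVL n ∘L ((1 / Real.pi : ℂ) • ContinuousLinearMap.id ℝ (Fin n → ℂ)))

def Kfun (g : ℂ → Fin n → ℂ) (ζ : ℂ) : Fin n → ℂ := LL1 n (Op kk1 g ζ) + LL2 n (Op kk2 g ζ)

theorem Kfun_eq (g : ℂ → Fin n → ℂ) {ζ : ℂ} (h0 : ζ ≠ 0) :
    cauchyGreenV g ζ - conjVec (cauchyGreenV g (1 / (starRingEnd ℂ ζ))) = Kfun g ζ := by
  have h1 : cauchyGreenV g ζ = LL1 n (Op kk1 g ζ) := rfl
  have hc : (starRingEnd ℂ) ζ ≠ 0 := by simpa using h0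
  have h2 : cauchyGreenV g (1 / (starRingEnd ℂ ζ)) = (1 / Real.pi : ℂ) • Op kk2 g ζ := by
    unfold cauchyGreenV Op
    rw [neg_smul, ← smul_neg, ← integral_neg]
    congr 1
    apply integral_congr_ae
    filter_upwards with ω
    rw [← neg_smul]
    congr 1
    rw [kk2]
    have : ω - 1 / (starRingEnd ℂ) ζ = -((1 - (starRingEnd ℂ) ζ * ω) / (starRingEnd ℂ) ζ) := by
      field_simp; ring
    rw [this, inv_neg, neg_neg, inv_div]
  rw [h1, h2, Kfun, sub_eq_add_neg]
  rfl

theorem Kfun_jet {α : ℝ} (hα : α ∈ Set.Ioo (0 : ℝ) 1) (n : ℕ) :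
    ∃ CK : ℝ, 0 ≤ CK ∧ ∀ (g : ℂ → Fin n → ℂ) (C : ℝ), HB α g C →
      MemX α (Kfun g) ∧ normX α (Kfun g) ≤ CK * C := by
  obtain ⟨C1, h1, hJ1⟩ := ker1.Jet hα (ContinuousLinearMap.id ℝ ℂ) (fun h => rfl) (fun h => le_rfl)
  obtain ⟨C2, h2, hJ2⟩ := ker2.Jet hα conjL (fun h => rfl)
    (fun h => by rw [conjL_apply, RCLike.norm_conj])
  refine ⟨26 * (‖LL1 n‖ * C1 + ‖LL2 n‖ * C2), by positivity, fun g C hg => ?_⟩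
  have J := ((hJ1 n g C hg).clm (LL1 n)).add ((hJ2 n g C hg).clm (LL2 n))
  have := J.memX hα
  refine ⟨this.1, this.2.trans (le_of_eq (by ring))⟩

theorem Op_add {α : ℝ} (hα : 0 < α) {k l : ℂ → ℂ → ℂ} {s : ℂ → ℂ} {σ : ℂ} (K : Ker k l s σ)
    {g g' : ℂ → Fin n → ℂ} {C C' : ℝ} (hg : HB α g C) (hg' : HB α g' C') {ζ : ℂ} (hζ : ζ ∈ cD) :
    Op k (fun ω => g ω + g' ω) ζ = Op k g ζ + Op k g' ζ := by
  unfold Op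
  simp_rw [smul_add]
  exact integral_add (K.k_int hα hg hζ).1 (K.k_int hα hg' hζ).1

theorem Op_smul (k : ℂ → ℂ → ℂ) (g : ℂ → Fin n → ℂ) (c : ℝ) (ζ : ℂ) :
    Op k (fun ω => c • g ω) ζ = c • Op k g ζ := by
  unfold Op
  simp_rw [smul_comm _ c]
  exact integral_smul c _

theorem Op_congr (k : ℂ → ℂ → ℂ) {g g' : ℂ → Fin n → ℂ} (h : ∀ ω ∈ cD, g ω = g' ω) (ζ : ℂ) :
    Op k g ζ = Op k g' ζ := by
  unfold Op
  apply setIntegral_congr_fun measurableSet_ball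
  intro ω hω
  simp only [h ω (ball_sub_cD hω)]

theorem Kfun_add {α : ℝ} (hα : 0 < α) {g g' : ℂ → Fin n → ℂ} {C C' : ℝ} (hg : HB α g C)
    (hg' : HB α g' C') {ζ : ℂ} (hζ : ζ ∈ cD) :
    Kfun (fun ω => g ω + g' ω) ζ = Kfun g ζ + Kfun g' ζ := by
  unfold Kfun
  rw [Op_add hα ker1 hg hg' hζ, Op_add hα ker2 hg hg' hζ, map_add, map_add]; abel

theorem Kfun_smul (g : ℂ → Fin n → ℂ) (c : ℝ) (ζ : ℂ) :
    Kfun (fun ω => c • g ω) ζ = c • Kfun g ζ := by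
  unfold Kfun
  rw [Op_smul, Op_smul, map_smul, map_smul, smul_add]

theorem Kfun_congr {g g' : ℂ → Fin n → ℂ} (h : ∀ ω ∈ cD, g ω = g' ω) (ζ : ℂ) :
    Kfun g ζ = Kfun g' ζ := by
  unfold Kfun
  rw [Op_congr _ h, Op_congr _ h]
end


/-! ### An abstract implicit function theorem -/

theorem ift {Y P Q : Type} [NormedAddCommGroup Y] [NormedSpace ℝ Y] [CompleteSpace Y]
    [NormedAddCommGroup P] [NormedSpace ℝ P] [CompleteSpace P]
    [NormedAddCommGroup Q] [NormedSpace ℝ Q]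
    (Θ : Q × P → Y) (hΘ : ContDiff ℝ (⊤ : ℕ∞) Θ) (hΘ0 : Θ 0 = 0)
    (hΘ' : HasFDerivAt Θ (0 : Q × P →L[ℝ] Y) 0) (KP : Y →L[ℝ] Q) :
    ∃ ρ : ℝ, 0 < ρ ∧ ∃ r : ℝ, 0 < r ∧ ∃ γ : P → Y,
      (∀ p, ‖p‖ < r → γ p = Θ (KP (γ p), p)) ∧
      ContDiffOn ℝ (⊤ : ℕ∞) γ (ball 0 r) ∧
      (∀ p, ‖p‖ < r → ∀ g, ‖g‖ < ρ → g = Θ (KP g, p) → g = γ p) := by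
  let L : Y × P →L[ℝ] Q × P :=
    (KP ∘L ContinuousLinearMap.fst ℝ Y P).prod (ContinuousLinearMap.snd ℝ Y P)
  let Ψ : Y × P → Y × P := fun x => (x.1 - Θ (L x), x.2)
  have hL0 : L 0 = 0 := map_zero L
  have hΨ : ContDiff ℝ (⊤ : ℕ∞) Ψ :=
    (contDiff_fst.sub (hΘ.comp L.contDiff)).prodMk contDiff_snd
  have hΨ' : HasFDerivAt Ψ ((ContinuousLinearEquiv.refl ℝ (Y × P) : (Y × P) ≃L[ℝ] (Y × P)) : Y × P →L[ℝ] Y × P) 0 := by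
    have h1 : HasFDerivAt (fun x => Θ (L x)) ((0 : Q × P →L[ℝ] Y) ∘L L) 0 := by
      refine HasFDerivAt.comp (g := Θ) (f := L) 0 ?_ L.hasFDerivAt
      rw [hL0]; exact hΘ'
    have h2 := (hasFDerivAt_fst.sub h1).prodMk (hasFDerivAt_snd (𝕜 := ℝ) (p := (0 : Y × P)))
    refine h2.congr_fderiv ?_
    ext x <;> simp
  have hΨ0 : Ψ 0 = 0 := by
    simp only [Ψ, hL0, hΘ0]; simp
  let e := hΨ.contDiffAt.toOpenPartialHomeomorph Ψ hΨ' (by simp)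
  have ecoe : (e : Y × P → Y × P) = Ψ := rfl
  have h0s : (0 : Y × P) ∈ e.source := hΨ.contDiffAt.mem_toOpenPartialHomeomorph_source hΨ' (by simp)
  have h0t : (0 : Y × P) ∈ e.target := by
    have := e.map_source h0s
    rwa [ecoe, hΨ0] at this
  have hs0 : e.symm 0 = 0 := by
    have := e.left_inv h0s
    rwa [ecoe, hΨ0] at this
  have hS : {x : Y × P | fderiv ℝ Ψ x ∈ Set.range ((↑) : ((Y × P) ≃L[ℝ] (Y × P)) → (Y × P →L[ℝ] Y × P))} ∈ nhds (0 : Y × P) := by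
    have hc : ContinuousAt (fderiv ℝ Ψ) 0 := (hΨ.continuous_fderiv (by simp)).continuousAt
    apply hc
    rw [hΨ'.fderiv]
    exact ContinuousLinearEquiv.nhds _
  have hT : {y : Y × P | y ∈ e.target ∧ e.symm y ∈ {x : Y × P | fderiv ℝ Ψ x ∈ Set.range ((↑) : ((Y × P) ≃L[ℝ] (Y × P)) → (Y × P →L[ℝ] Y × P))}} ∈ nhds (0 : Y × P) := by
    refine Filter.inter_mem (e.open_target.mem_nhds h0t) ?_
    have hc : ContinuousAt e.symm 0 := e.continuousAt_symm h0t
    rw [ContinuousAt, hs0] at hc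
    exact hc hS
  obtain ⟨ρ, hρ, hρs⟩ := Metric.mem_nhds_iff.1 (e.open_source.mem_nhds h0s)
  obtain ⟨r, hr, hrs⟩ := Metric.mem_nhds_iff.1 hT
  have hin : ∀ p : P, ‖p‖ < r → ((0 : Y), p) ∈ ball (0 : Y × P) r := by
    intro p hp
    rw [mem_ball_zero_iff, Prod.norm_def]
    simpa using hp
  refine ⟨ρ, hρ, min r ρ, lt_min hr hρ, fun p => (e.symm (0, p)).1, ?_, ?_, ?_⟩
  · intro p hp
    have h := hrs (hin p (hp.trans_le (min_le_left _ _)))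
    have h2 := e.right_inv h.1
    rw [ecoe] at h2
    have a := congrArg Prod.fst h2
    have b := congrArg Prod.snd h2
    simp only [Ψ] at a b
    have c := sub_eq_zero.1 a
    have d : L (e.symm (0, p)) = (KP (e.symm (0, p)).1, p) := by
      exact Prod.ext rfl b
    rw [d] at c
    exact c
  · intro p hp
    rw [mem_ball_zero_iff] at hp
    have h := hrs (hin p (hp.trans_le (min_le_left _ _)))
    obtain ⟨A, hA⟩ := h.2
    have h3 : ContDiffAt ℝ (⊤ : ℕ∞) e.symm (0, p) := by
      refine e.contDiffAt_symm (f₀' := A) h.1 ?_ hΨ.contDiffAt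
      rw [hA]
      exact (hΨ.differentiable (by simp)).differentiableAt.hasFDerivAt
    have h4 : ContDiffAt ℝ (⊤ : ℕ∞) (fun p : P => e.symm ((0 : Y), p)) p :=
      h3.comp p (contDiff_const.prodMk contDiff_id).contDiffAt
    exact (contDiff_fst.contDiffAt.comp p h4).contDiffWithinAt
  · intro p hp g hg h
    have hs : (g, p) ∈ e.source := by
      apply hρs
      rw [mem_ball_zero_iff, Prod.norm_def]
      simpa using ⟨hg, hp.trans_le (min_le_right _ _)⟩
    have h1 : e (g, p) = (0, p) := by
      rw [ecoe]; simp only [Ψ, L]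
      ext1
      · simp only; rw [sub_eq_zero]; exact h
      · rfl
    have := e.left_inv hs
    rw [h1] at this
    simp only [this]


/-! ### Assembly -/

section
variable {n : ℕ} {α : ℝ} {f f' : ℂ → Fin n → ℂ}

instance holSMul (α : ℝ) (n : ℕ) : SMul ℝ (Hol α (Fin n → ℂ)) :=
  (inferInstance : Module ℝ (Hol α (Fin n → ℂ))).toSMul

instance holSMul2 (α : ℝ) (n : ℕ) : SMul ℝ (Hol α (Fin n → ℂ) × Hol α (Fin n → ℂ)) :=
  (inferInstance : Module ℝ (Hol α (Fin n → ℂ) × Hol α (Fin n → ℂ))).toSMul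

def jetY (α : ℝ) (f : ℂ → Fin n → ℂ) : Hol α (Fin n → ℂ) × Hol α (Fin n → ℂ) :=
  (toHol α f, toHol α (wdzD f))

theorem jetY_add (hα : α ∈ Set.Ioo (0 : ℝ) 1) (hf : MemX α f) (hf' : MemX α f') :
    jetY α (fun x => f x + f' x) = jetY α f + jetY α f' := by
  refine Prod.ext (Hol_ext fun x hx => ?_) (Hol_ext fun x hx => ?_)
  · change ev (toHol α _) x = ev (toHol α f + toHol α f') x
    rw [ev_add, ev_toHol ((hf.add hf').HB hα) hx, ev_toHol (hf.HB hα) hx, ev_toHol (hf'.HB hα) hx]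
  · change ev (toHol α _) x = ev (toHol α (wdzD f) + toHol α (wdzD f')) x
    rw [ev_add, ev_toHol ((hf.add hf').HB') hx, ev_toHol (hf.HB') hx, ev_toHol (hf'.HB') hx,
      wdzD_add hf hf' hx]

theorem jetY_smul (hα : α ∈ Set.Ioo (0 : ℝ) 1) (hf : MemX α f) (c : ℝ) :
    jetY α (fun x => c • f x) =
      (c • (jetY α f) : Hol α (Fin n → ℂ) × Hol α (Fin n → ℂ)) := by
  refine Prod.ext (Hol_ext fun x hx => ?_) (Hol_ext fun x hx => ?_)
  · change ev (toHol α _) x = ev (c • toHol α f) x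
    rw [ev_smul, ev_toHol ((hf.smul c).HB hα) hx, ev_toHol (hf.HB hα) hx]
  · change ev (toHol α _) x = ev (c • toHol α (wdzD f)) x
    rw [ev_smul, ev_toHol ((hf.smul c).HB') hx, ev_toHol (hf.HB') hx, wdzD_smul hf c hx]

theorem jetY_congr (hα : α ∈ Set.Ioo (0 : ℝ) 1) (hf : MemX α f) (h : ∀ x ∈ cD, f' x = f x) :
    jetY α f' = jetY α f := by
  refine Prod.ext (Hol_ext fun x hx => ?_) (Hol_ext fun x hx => ?_)
  · change ev (toHol α _) x = ev (toHol α f) x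
    rw [ev_toHol ((hf.congr h).HB hα) hx, ev_toHol (hf.HB hα) hx, h x hx]
  · change ev (toHol α _) x = ev (toHol α (wdzD f)) x
    rw [ev_toHol ((hf.congr h).HB') hx, ev_toHol (hf.HB') hx, wdzD_congr h hx]

theorem jetY_norm (hα : α ∈ Set.Ioo (0 : ℝ) 1) (hf : MemX α f) :
    ‖jetY α f‖ ≤ 4 * normX α f := by
  rw [Prod.norm_def]
  exact max_le (norm_toHol_le (hf.HB hα)) (norm_toHol_le hf.HB')

theorem exists_KP (hα : α ∈ Set.Ioo (0 : ℝ) 1) (n : ℕ) :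
    ∃ KP : Hol α (Fin n → ℂ) →L[ℝ] (Hol α (Fin n → ℂ) × Hol α (Fin n → ℂ)),
      ∀ g, KP g = jetY α (Kfun (ev g)) := by
  obtain ⟨CK, hCK, hK⟩ := Kfun_jet hα n
  have hm : ∀ g : Hol α (Fin n → ℂ), MemX α (Kfun (ev g)) := fun g => (hK _ _ (ev_HB g)).1
  refine ⟨LinearMap.mkContinuous
    { toFun := fun g => jetY α (Kfun (ev g))
      map_add' := fun g g' => ?_
      map_smul' := fun c g => ?_ } (4 * CK) ?_, fun g => rfl⟩
  · rw [← jetY_add hα (hm g) (hm g')]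
    apply jetY_congr hα ((hm g).add (hm g'))
    intro x hx
    rw [← Kfun_add hα.1 (ev_HB g) (ev_HB g') hx]
    exact Kfun_congr (fun ω _ => ev_add g g' ω) x
  · rw [RingHom.id_apply, ← jetY_smul hα (hm g)]
    apply jetY_congr hα ((hm g).smul c)
    intro x hx
    rw [← Kfun_smul]
    exact Kfun_congr (fun ω _ => ev_smul c g ω) x
  · intro g
    have h1 := jetY_norm hα (hm g)
    have h2 := (hK _ _ (ev_HB g)).2
    change ‖jetY α (Kfun (ev g))‖ ≤ _
    linarith

theorem memX_model (hα : α ∈ Set.Ioo (0 : ℝ) 1) {F : ℂ → ℂ} {D C} (J : Jet α F D C)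
    (c t : Fin n → ℝ) : MemX α (modelZ F c t) := by
  let L : ℂ →L[ℝ] (Fin n → ℂ) := ContinuousLinearMap.pi fun j => (t j : ℂ) • ContinuousLinearMap.id ℝ ℂ
  have J2 := (J.clm L).add (Jet.const (α := α) (fun j => Complex.I * (c j : ℂ) : Fin n → ℂ))
  exact (J2.memX hα).1

abbrev Par (n : ℕ) := (Fin n → ℝ) × (Fin n → ℝ) × ℝ

theorem exists_MM (hα : α ∈ Set.Ioo (0 : ℝ) 1) (n : ℕ) {F : ℂ → ℂ} {D C} (J : Jet α F D C) :
    ∃ MM : Par n →L[ℝ] (Hol α (Fin n → ℂ) × Hol α (Fin n → ℂ)),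
      ∀ p, MM p = jetY α (modelZ F p.1 p.2.1) := by
  have hm : ∀ p : Par n, MemX α (modelZ F p.1 p.2.1) := fun p => memX_model hα J _ _
  let M0 : Par n →ₗ[ℝ] (Hol α (Fin n → ℂ) × Hol α (Fin n → ℂ)) :=
    { toFun := fun p => jetY α (modelZ F p.1 p.2.1)
      map_add' := fun p p' => by
        rw [← jetY_add hα (hm p) (hm p')]
        congr 1
        funext x j
        simp [modelZ]; ring
      map_smul' := fun c p => by
        rw [RingHom.id_apply, ← jetY_smul hα (hm p)]
        congr 1
        funext x j
        simp [modelZ]; ring }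
  exact ⟨LinearMap.toContinuousLinearMap M0, fun p => rfl⟩

theorem exists_L3' (α : ℝ) (E1 E2 : Type) [NormedAddCommGroup E1] [NormedSpace ℝ E1]
    [NormedAddCommGroup E2] [NormedSpace ℝ E2] :
    ∃ L3 : ((Hol α E1 × Hol α E2) × ℝ) →L[ℝ] Hol α (E1 × E2 × ℝ),
      ∀ q s, ∀ x ∈ cD, ev (L3 (q, s)) x = (ev q.1 x, ev q.2 x, s) := by
  have hB : ∀ q : (Hol α E1 × Hol α E2) × ℝ,
      HB α (fun x => ((ev q.1.1 x, ev q.1.2 x, q.2) : E1 × E2 × ℝ)) ‖q‖ := by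
    intro q
    have a1 : ‖q.1.1‖ ≤ ‖q‖ := (norm_fst_le q.1).trans (norm_fst_le q)
    have a2 : ‖q.1.2‖ ≤ ‖q‖ := (norm_snd_le q.1).trans (norm_fst_le q)
    have a3 : ‖q.2‖ ≤ ‖q‖ := norm_snd_le q
    refine ⟨fun x hx => ?_, fun x hx y hy => ?_⟩
    · rw [Prod.norm_def, Prod.norm_def]
      exact max_le ((norm_ev_le _ _).trans a1) (max_le ((norm_ev_le _ _).trans a2) a3)
    · rw [Prod.norm_def, Prod.norm_def]
      refine max_le ((ev_holder q.1.1 hx hy).trans ?_)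
        (max_le ((ev_holder q.1.2 hx hy).trans ?_) ?_)
      · gcongr
      · gcongr
      · simp; positivity
  refine ⟨LinearMap.mkContinuous
    { toFun := fun q => toHol α (fun x => ((ev q.1.1 x, ev q.1.2 x, q.2) : E1 × E2 × ℝ))
      map_add' := fun q q' => ?_
      map_smul' := fun c q => ?_ } 1 ?_, fun q s x hx => ev_toHol (hB (q, s)) hx⟩
  · apply Hol_ext
    intro x hx
    rw [ev_add, ev_toHol (hB _) hx, ev_toHol (hB _) hx, ev_toHol (hB _) hx]
    simp only [Prod.fst_add, Prod.snd_add, ev_add, Prod.mk_add_mk]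
  · apply Hol_ext
    intro x hx
    refine Eq.trans (ev_toHol (hB _) hx) ?_
    refine Eq.trans ?_ (ev_smul c _ x).symm
    rw [ev_toHol (hB _) hx]
    exact Prod.ext (ev_smul c _ x) (Prod.ext (ev_smul c _ x) rfl)
  · intro q
    rw [one_mul]
    exact norm_toHol_le (hB q)

theorem exists_L3 (α : ℝ) (n : ℕ) :
    ∃ L3 : ((Hol α (Fin n → ℂ) × Hol α (Fin n → ℂ)) × ℝ) →L[ℝ]
        Hol α ((Fin n → ℂ) × (Fin n → ℂ) × ℝ),
      ∀ q s, ∀ x ∈ cD, ev (L3 (q, s)) x = (ev q.1 x, ev q.2 x, s) :=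
  exists_L3' α _ _

/-- the nonlinearity -/
def hh (A : (Fin n → ℂ) → ℝ → Matrix (Fin n) (Fin n) ℂ) (e : (Fin n → ℂ) × (Fin n → ℂ) × ℝ) :
    Fin n → ℂ := (A e.1 e.2.2).mulVec (conjVec e.2.1)

theorem hh_smooth {A : (Fin n → ℂ) → ℝ → Matrix (Fin n) (Fin n) ℂ}
    (hA : ∀ j k, ContDiff ℝ (⊤ : ℕ∞) fun p : (Fin n → ℂ) × ℝ => A p.1 p.2 j k) :
    ContDiff ℝ (⊤ : ℕ∞) (hh A) := by
  rw [contDiff_pi]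
  intro j
  change ContDiff ℝ _ (fun e : (Fin n → ℂ) × (Fin n → ℂ) × ℝ => ∑ k, A e.1 e.2.2 j k * conjL (e.2.1 k))
  refine ContDiff.sum fun k _ => ContDiff.mul ?_ ?_
  · exact (hA j k).comp (contDiff_fst.prodMk (contDiff_snd.comp contDiff_snd))
  · exact conjL.contDiff.comp ((contDiff_apply ℝ ℂ k).comp (contDiff_fst.comp contDiff_snd))

theorem hh_fderiv {A : (Fin n → ℂ) → ℝ → Matrix (Fin n) (Fin n) ℂ}
    (hA : ∀ j k, ContDiff ℝ (⊤ : ℕ∞) fun p : (Fin n → ℂ) × ℝ => A p.1 p.2 j k)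
    (hA0 : ∀ w, A w 0 = 0) : fderiv ℝ (hh A) 0 = 0 := by
  apply HasFDerivAt.fderiv
  rw [hasFDerivAt_pi']
  intro j
  change HasFDerivAt (fun e : (Fin n → ℂ) × (Fin n → ℂ) × ℝ => ∑ k, A e.1 e.2.2 j k * conjL (e.2.1 k)) _ 0
  have h1 : ∀ k ∈ Finset.univ, HasFDerivAt (fun e : (Fin n → ℂ) × (Fin n → ℂ) × ℝ => A e.1 e.2.2 j k * conjL (e.2.1 k))
      (0 : (Fin n → ℂ) × (Fin n → ℂ) × ℝ →L[ℝ] ℂ) 0 := by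
    intro k _
    have s1 : ContDiff ℝ (⊤ : ℕ∞) (fun e : (Fin n → ℂ) × (Fin n → ℂ) × ℝ => A e.1 e.2.2 j k) :=
      (hA j k).comp (contDiff_fst.prodMk (contDiff_snd.comp contDiff_snd))
    have s2 : ContDiff ℝ (⊤ : ℕ∞) (fun e : (Fin n → ℂ) × (Fin n → ℂ) × ℝ => conjL (e.2.1 k)) :=
      conjL.contDiff.comp ((contDiff_apply ℝ ℂ k).comp (contDiff_fst.comp contDiff_snd))
    have d1 := ((s1.differentiable (by simp)) 0).hasFDerivAt
    have d2 := ((s2.differentiable (by simp)) 0).hasFDerivAt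
    refine (d1.mul d2).congr_fderiv ?_
    have z : A (0 : (Fin n → ℂ) × (Fin n → ℂ) × ℝ).1 (0 : (Fin n → ℂ) × (Fin n → ℂ) × ℝ).2.2 j k = 0 := by
      have := hA0 0
      exact congrFun (congrFun this j) k
    rw [z]
    ext <;> simp
  refine (HasFDerivAt.fun_sum h1).congr_fderiv ?_
  simp
end

section
theorem theta_gen {α : ℝ} {E F Q : Type} [NormedAddCommGroup E] [NormedSpace ℝ E] [ProperSpace E]
    [NormedAddCommGroup F] [NormedSpace ℝ F] [NormedAddCommGroup Q] [NormedSpace ℝ Q]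
    (L : Q →L[ℝ] Hol α E) {h : E → F} (hh : ContDiff ℝ (⊤ : ℕ∞) h) (h0 : h 0 = 0)
    (h1 : fderiv ℝ h 0 = 0) :
    ContDiff ℝ (⊤ : ℕ∞) (fun z => nem α h (L z)) ∧ nem α h (L 0) = 0 ∧
      HasFDerivAt (fun z => nem α h (L z)) (0 : Q →L[ℝ] Hol α F) 0 := by
  refine ⟨(nem_contDiff hh).comp (ContinuousLinearMap.contDiff (𝕜 := ℝ) (E := Q) (F := Hol α E) L), ?_, ?_⟩
  · apply Hol_ext
    intro x hx
    rw [ev_nem hh _ hx, map_zero, ev_zero, ev_zero, h0]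
  · have a := nem_hasFDerivAt (α := α) hh (L 0)
    have b : nem α (fderiv ℝ h) (L 0) = 0 := by
      apply Hol_ext
      intro x hx
      rw [ev_nem (hh.fderiv_right (by simp)) _ hx, map_zero, ev_zero, ev_zero, h1]
    rw [b, ContinuousLinearMap.map_zero] at a
    have c := a.comp (0 : Q) L.hasFDerivAt
    rw [ContinuousLinearMap.zero_comp] at c
    exact c

variable {n : ℕ} {α : ℝ}

theorem core (hα : α ∈ Set.Ioo (0 : ℝ) 1) {F : ℂ → ℂ} {D C} (J : Jet α F D C)
    {A : (Fin n → ℂ) → ℝ → Matrix (Fin n) (Fin n) ℂ}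
    (hA : ∀ j k, ContDiff ℝ (⊤ : ℕ∞) fun p : (Fin n → ℂ) × ℝ => A p.1 p.2 j k)
    (hA0 : ∀ w, A w 0 = 0) :
    ∃ (KP : Hol α (Fin n → ℂ) →L[ℝ] (Hol α (Fin n → ℂ) × Hol α (Fin n → ℂ)))
      (MM : Par n →L[ℝ] (Hol α (Fin n → ℂ) × Hol α (Fin n → ℂ)))
      (Θ : (Hol α (Fin n → ℂ) × Hol α (Fin n → ℂ)) × Par n → Hol α (Fin n → ℂ)),
      (∀ g, KP g = jetY α (Kfun (ev g))) ∧ (∀ p, MM p = jetY α (modelZ F p.1 p.2.1)) ∧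
      (∀ q p f, MemX α f → q + MM p = jetY α f → ∀ x ∈ cD,
        ev (Θ (q, p)) x = (A (f x) p.2.2).mulVec (conjVec (wdzD f x))) ∧
      ContDiff ℝ (⊤ : ℕ∞) Θ ∧ Θ 0 = 0 ∧ HasFDerivAt Θ
        (0 : (Hol α (Fin n → ℂ) × Hol α (Fin n → ℂ)) × Par n →L[ℝ] Hol α (Fin n → ℂ)) 0 := by
  obtain ⟨KP, hKP⟩ := exists_KP hα n
  obtain ⟨MM, hMM⟩ := exists_MM hα n J
  obtain ⟨L3, hL3⟩ := exists_L3 α n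
  let S : (Hol α (Fin n → ℂ) × Hol α (Fin n → ℂ)) × Par n →L[ℝ]
      (Hol α (Fin n → ℂ) × Hol α (Fin n → ℂ)) × ℝ :=
    ((ContinuousLinearMap.fst ℝ _ (Par n)) + MM.comp (ContinuousLinearMap.snd ℝ _ (Par n))).prod
      ((ContinuousLinearMap.snd ℝ (Fin n → ℝ) ℝ).comp
        ((ContinuousLinearMap.snd ℝ (Fin n → ℝ) _).comp (ContinuousLinearMap.snd ℝ _ (Par n))))
  have hS : ∀ q p, S (q, p) = (q + MM p, p.2.2) := fun q p => rfl
  have hz : hh A 0 = 0 := by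
    change (A 0 0).mulVec _ = 0
    rw [hA0, Matrix.zero_mulVec]
  obtain ⟨t1, t2, t3⟩ := theta_gen (L3.comp S) (hh_smooth hA) hz (hh_fderiv hA hA0)
  refine ⟨KP, MM, fun z => nem α (hh A) (L3.comp S z), hKP, hMM, ?_, t1, t2, t3⟩
  intro q p f hf hq x hx
  have e : L3.comp S (q, p) = L3 (q + MM p, p.2.2) := rfl
  change ev (nem α (hh A) (L3.comp S (q, p))) x = _
  rw [ev_nem (hh_smooth hA) _ hx, e, hL3 _ _ _ hx, hq]
  change hh A (ev (toHol α f) x, ev (toHol α (wdzD f)) x, p.2.2) = _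
  rw [ev_toHol (hf.HB hα) hx, ev_toHol hf.HB' hx]
  rfl
end


theorem bishopH_eq {n : ℕ} (F : ℂ → ℂ) (A : (Fin n → ℂ) → ℝ → Matrix (Fin n) (Fin n) ℂ)
    (z : ℂ → Fin n → ℂ) (c t : Fin n → ℝ) (lam : ℝ) {ζ : ℂ} (h0 : ζ ≠ 0) :
    bishopH F A z c t lam ζ = modelZ F c t ζ +
      Kfun (fun ω => (A (z ω) lam).mulVec (conjVec (wdzD z ω))) ζ := by
  unfold bishopH
  rw [add_sub_assoc, Kfun_eq _ h0]

set_option maxHeartbeats 1000000 in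
theorem bishop_aux
    (n : ℕ) (α : ℝ) (hα : α ∈ Set.Ioo (0 : ℝ) 1)
    (φ : ℂ → ℝ)
    (hφreg : ContDiff ℝ 1 (fun θ : ℝ => φ (Complex.exp (θ * Complex.I))))
    (hφreg' : HolderOn α (deriv fun θ : ℝ => φ (Complex.exp (θ * Complex.I))) Set.univ)
    (hφ0 : ∀ w ∈ upperArc, φ w = 0)
    (hφneg : ∀ w ∈ lowerArc, φ w < 0)
    (A : (Fin n → ℂ) → ℝ → Matrix (Fin n) (Fin n) ℂ)
    (hA : ∀ j k, ContDiff ℝ (⊤ : ℕ∞) fun p : (Fin n → ℂ) × ℝ => A p.1 p.2 j k)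
    (hA0 : ∀ w, A w 0 = 0) :
    ∀ F : ℂ → ℂ, ContinuousOn F (closedBall (0 : ℂ) 1) →
      (∀ ζ ∈ ball (0 : ℂ) 1, F ζ = schwarz φ ζ) →
    ∃ ε : ℝ, 0 < ε ∧ ∃ δ : ℝ, 0 < δ ∧
      ∃ sol : (Fin n → ℝ) → (Fin n → ℝ) → ℝ → ℂ → Fin n → ℂ,
        (∀ (c t : Fin n → ℝ) (lam : ℝ), ‖c‖ + ‖t‖ + |lam| < δ →
          -- existence: the solution lies in X, solves the equation,
          -- and is ε-close to the model disc
          MemX α (sol c t lam) ∧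
          (∀ ζ ∈ closedBall (0 : ℂ) 1, ζ ≠ 0 →
            sol c t lam ζ = bishopH F A (sol c t lam) c t lam ζ) ∧
          normX α (fun ζ => sol c t lam ζ - modelZ F c t ζ) < ε ∧
          -- uniqueness among elements of X that are ε-close to the model disc
          (∀ w : ℂ → Fin n → ℂ, MemX α w →
            (∀ ζ ∈ closedBall (0 : ℂ) 1, ζ ≠ 0 → w ζ = bishopH F A w c t lam ζ) →
            normX α (fun ζ => w ζ - modelZ F c t ζ) < ε →
            ∀ ζ ∈ closedBall (0 : ℂ) 1, w ζ = sol c t lam ζ)) ∧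
        -- smooth dependence on the parameters (c,t,λ)
        (∀ ζ ∈ closedBall (0 : ℂ) 1,
          ContDiffOn ℝ (⊤ : ℕ∞)
            (fun p : (Fin n → ℝ) × (Fin n → ℝ) × ℝ => sol p.1 p.2.1 p.2.2 ζ)
            {p : (Fin n → ℝ) × (Fin n → ℝ) × ℝ | ‖p.1‖ + ‖p.2.1‖ + |p.2.2| < δ}) ∧
        -- for t = 0 the solution is the constant disc i·c
        (∀ (c : Fin n → ℝ) (lam : ℝ), ‖c‖ + |lam| < δ →
          ∀ ζ ∈ closedBall (0 : ℂ) 1,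
            sol c 0 lam ζ = fun j => Complex.I * (c j : ℂ)) := by
  intro F hFc hFs
  obtain ⟨D, C, J⟩ := F_jet hα φ hφreg hφreg' F hFc hFs
  obtain ⟨CK, hCK0, hCK⟩ := Kfun_jet hα n
  obtain ⟨KP, MM, Θ, hKP, hMM, hΘ, hΘs, hΘ0, hΘd⟩ := core (n := n) hα J hA hA0
  obtain ⟨ρ, hρ, r, hr, γ, hγ, hγs, hγu⟩ := ift Θ hΘs hΘ0 hΘd KP
  have hmod : ∀ c t : Fin n → ℝ, MemX α (modelZ F c t) := fun c t => memX_model hα J c t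
  have hKm : ∀ g : Hol α (Fin n → ℂ), MemX α (Kfun (ev g)) := fun g => (hCK _ _ (ev_HB g)).1
  have hKn : ∀ g : Hol α (Fin n → ℂ), normX α (Kfun (ev g)) ≤ CK * ‖g‖ :=
    fun g => (hCK _ _ (ev_HB g)).2
  have hγ0 : γ 0 = 0 := by
    refine (hγu 0 (by simpa using hr) 0 (by simpa using hρ) ?_).symm
    rw [ContinuousLinearMap.map_zero]
    exact hΘ0.symm
  have hγc : ContinuousAt γ 0 :=
    (hγs.continuousOn 0 (mem_ball_self hr)).continuousAt (ball_mem_nhds 0 hr)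
  -- smallness of Θ near zero
  have hΘc : ContinuousAt Θ 0 := hΘs.continuous.continuousAt
  obtain ⟨s, hs, hsΘ⟩ := Metric.continuousAt_iff.1 hΘc ρ hρ
  obtain ⟨d, hd, hdγ⟩ := Metric.continuousAt_iff.1 hγc (s / 4 / (CK + 1)) (by positivity)
  have hp : ∀ {δ : ℝ} {c t : Fin n → ℝ} {lam : ℝ}, ‖c‖ + ‖t‖ + |lam| < δ →
      ‖((c, t, lam) : Par n)‖ < δ := by
    intro δ c t lam h
    have h1 := norm_nonneg c
    have h2 := norm_nonneg t
    have h3 := abs_nonneg lam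
    rw [Prod.norm_def, Prod.norm_def, Real.norm_eq_abs]
    exact max_lt (by linarith) (max_lt (by dsimp only; linarith) (by dsimp only; linarith))
  refine ⟨s / 4, by positivity, min r (min s d), by positivity,
    fun c t lam ζ => modelZ F c t ζ + Kfun (ev (γ (c, t, lam))) ζ, ?_, ?_, ?_⟩
  · intro c t lam h
    have hP := hp h
    set p : Par n := (c, t, lam) with hpdef
    have hPr : ‖p‖ < r := hP.trans_le (min_le_left _ _)
    have hPs : ‖p‖ < s := hP.trans_le ((min_le_right _ _).trans (min_le_left _ _))
    have hPd : ‖p‖ < d := hP.trans_le ((min_le_right _ _).trans (min_le_right _ _))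
    have hX : MemX α (fun ζ => modelZ F c t ζ + Kfun (ev (γ p)) ζ) := (hmod c t).add (hKm (γ p))
    have hj : KP (γ p) + MM p = jetY α (fun ζ => modelZ F c t ζ + Kfun (ev (γ p)) ζ) := by
      rw [jetY_add hα (hmod c t) (hKm (γ p)), hKP, hMM, add_comm]
    refine ⟨hX, ?_, ?_, ?_⟩
    · intro ζ hζ h0
      have e : ∀ x ∈ cD, ev (γ p) x = _ := fun x hx =>
        (congrArg (fun g => ev g x) (hγ p hPr)).trans (hΘ _ p _ hX hj x hx)
      refine Eq.trans ?_ (bishopH_eq F A _ c t lam h0).symm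
      exact congrArg (fun v => modelZ F c t ζ + v) (Kfun_congr e ζ)
    · have e : (fun ζ => modelZ F c t ζ + Kfun (ev (γ p)) ζ - modelZ F c t ζ) = Kfun (ev (γ p)) := by
        funext ζ
        rw [add_sub_cancel_left]
      change normX α (fun ζ => modelZ F c t ζ + Kfun (ev (γ p)) ζ - modelZ F c t ζ) < s / 4
      rw [e]
      have h1 : ‖γ p‖ < s / 4 / (CK + 1) := by
        have := @hdγ p (by rw [dist_zero_right]; exact hPd)
        rwa [hγ0, dist_zero_right] at this
      rw [lt_div_iff₀ (by positivity)] at h1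
      have h2 := hKn (γ p)
      have h3 := norm_nonneg (γ p)
      nlinarith
    · intro w hw hwe hwn
      have hu : MemX α (fun x => w x + (-1 : ℝ) • modelZ F c t x) := hw.add ((hmod c t).smul (-1))
      have hju : jetY α (fun x => w x + (-1 : ℝ) • modelZ F c t x) + MM p = jetY α w := by
        rw [hMM, ← jetY_add hα hu (hmod c t)]
        apply jetY_congr hα hw
        intro x _
        simp
      have hun : ‖jetY α (fun x => w x + (-1 : ℝ) • modelZ F c t x)‖ < s := by
        refine (jetY_norm hα hu).trans_lt ?_
        have e : (fun x => w x + (-1 : ℝ) • modelZ F c t x) = fun ζ => w ζ - modelZ F c t ζ := by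
          funext x
          simp [sub_eq_add_neg]
        rw [e]
        linarith
      set u := jetY α (fun x => w x + (-1 : ℝ) • modelZ F c t x) with hudef
      set g := Θ (u, p) with hg
      have hge : ∀ x ∈ cD, ev g x = _ := fun x hx => hΘ u p w hw hju x hx
      have hgn : ‖g‖ < ρ := by
        have := @hsΘ (u, p) (by rw [dist_zero_right]; exact max_lt hun hPs)
        rwa [hΘ0, dist_zero_right] at this
      have hX' : MemX α (fun ζ => modelZ F c t ζ + Kfun (ev g) ζ) := (hmod c t).add (hKm g)
      have hw1 : Set.EqOn w (fun ζ => modelZ F c t ζ + Kfun (ev g) ζ) (cD \ {0}) := by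
        intro ζ hζ
        refine (hwe ζ hζ.1 hζ.2).trans ((bishopH_eq F A w c t lam hζ.2).trans ?_)
        exact congrArg (fun v => modelZ F c t ζ + v) (Kfun_congr hge ζ).symm
      have hw2 : ∀ ζ ∈ cD, w ζ = modelZ F c t ζ + Kfun (ev g) ζ := by
        refine hw1.of_subset_closure hw.1.continuousOn hX'.1.continuousOn Set.diff_subset ?_
        intro x hx
        by_cases h0 : x = 0
        · subst h0
          have : (0 : ℂ) ∈ closure (ball (0 : ℂ) 1 \ {0}) := by
            have h1 := (dense_compl_singleton (0 : ℂ)).open_subset_closure_inter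
              (isOpen_ball (x := (0 : ℂ)) (ε := 1))
            rw [Set.diff_eq]
            exact h1 (mem_ball_self one_pos)
          exact closure_mono (Set.diff_subset_diff_left ball_subset_closedBall) this
        · exact subset_closure ⟨hx, h0⟩
      have hjw : u = KP g := by
        have e1 : jetY α w = KP g + MM p := by
          rw [jetY_congr hα hX' hw2, jetY_add hα (hmod c t) (hKm g), hKP, hMM, add_comm]
        rw [e1] at hju
        exact add_right_cancel hju
      have hgγ : g = γ p := hγu p hPr g hgn (by rw [← hjw])
      intro ζ hζ
      rw [hw2 ζ hζ, hgγ]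
  · intro ζ hζ
    have e : ∀ p : Par n, modelZ F p.1 p.2.1 ζ + Kfun (ev (γ (p.1, p.2.1, p.2.2))) ζ =
        evL α (Fin n → ℂ) ζ (MM p).1 + evL α (Fin n → ℂ) ζ (KP (γ p)).1 := by
      intro p
      rw [evL_apply, evL_apply, hMM, hKP]
      change _ = ev (toHol α _) ζ + ev (toHol α _) ζ
      rw [ev_toHol ((hmod _ _).HB hα) hζ, ev_toHol ((hKm _).HB hα) hζ]
    have hsub : {p : Par n | ‖p.1‖ + ‖p.2.1‖ + |p.2.2| < min r (min s d)} ⊆ ball 0 r := by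
      intro p hpp
      rw [mem_ball_zero_iff]
      exact (hp hpp).trans_le (min_le_left _ _)
    let Lm : Par n →L[ℝ] (Fin n → ℂ) :=
      (evL α (Fin n → ℂ) ζ).comp ((ContinuousLinearMap.fst ℝ _ _).comp MM)
    let Lk : Hol α (Fin n → ℂ) →L[ℝ] (Fin n → ℂ) :=
      (evL α (Fin n → ℂ) ζ).comp ((ContinuousLinearMap.fst ℝ _ _).comp KP)
    have hk : ContDiff ℝ (⊤ : ℕ∞) Lk :=
      ContinuousLinearMap.contDiff (𝕜 := ℝ) (E := Hol α (Fin n → ℂ)) (F := Fin n → ℂ) Lk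
    have hsm : ContDiffOn ℝ (⊤ : ℕ∞) (fun p : Par n => Lm p + Lk (γ p)) (ball 0 r) :=
      (Lm.contDiff.contDiffOn).add (hk.comp_contDiffOn hγs)
    exact (hsm.mono hsub).congr fun p _ => e p
  · intro c lam h ζ hζ
    have h' : ‖c‖ + ‖(0 : Fin n → ℝ)‖ + |lam| < min r (min s d) := by simpa using h
    have hPr : ‖((c, 0, lam) : Par n)‖ < r := (hp h').trans_le (min_le_left _ _)
    have hm0 : modelZ F c 0 = fun _ => fun j => Complex.I * (c j : ℂ) := by
      funext x j
      simp [modelZ]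
    have hz : (0 : Hol α (Fin n → ℂ)) = Θ (KP 0, (c, 0, lam)) := by
      apply Hol_ext
      intro x hx
      rw [hΘ (KP 0) (c, 0, lam) (modelZ F c 0) (hmod c 0)
        (by rw [ContinuousLinearMap.map_zero, zero_add, hMM]) x hx, ev_zero]
      have : wdzD (modelZ F c 0) x = 0 := by
        rw [hm0]
        simp [wdzD]
      rw [this]
      have h2 : conjVec (0 : Fin n → ℂ) = 0 := by
        funext j
        simp [conjVec]
      rw [h2, Matrix.mulVec_zero]
    have hγz : γ (c, 0, lam) = 0 :=
      (hγu (c, 0, lam) hPr 0 (by simpa using hρ) hz).symm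
    have hK0 : Kfun (ev (0 : Hol α (Fin n → ℂ))) ζ = 0 := by
      rw [Kfun_congr (g' := fun ω => (0 : ℝ) • (fun _ => (0 : Fin n → ℂ)) ω)
        (fun ω _ => by rw [ev_zero, zero_smul]) ζ, Kfun_smul, zero_smul]
    change modelZ F c 0 ζ + Kfun (ev (γ (c, 0, lam))) ζ = _
    rw [hγz, hK0, add_zero, hm0]

/-- existence of Bishop discs by the implicit function theorem: for a
`C^{1,α}` weight `φ` vanishing on `b𝔻⁺` and negative on `b𝔻⁻`, and a smooth family of
complex matrices `A(·,λ)` with `A(·,0) = 0`, there are `ε, δ > 0` such that for all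
parameters `(c,t,λ)` with `|c| + |t| + |λ| < δ` the Bishop equation `z = H(z,c,t,λ)` has
a unique solution in `X = C^{1,α}(𝔻̄,ℂⁿ)` at distance `< ε` from the model disc
`z⁰(c,t)`; the solutions depend smoothly on `(c,t,λ)`, and for `t = 0` they are the
constant discs `i·c`. -/
theorem bishop_discs_exist
    (n : ℕ) (α : ℝ) (hα : α ∈ Set.Ioo (0 : ℝ) 1)
    (φ : ℂ → ℝ)
    (hφreg : ContDiff ℝ 1 (fun θ : ℝ => φ (Complex.exp (θ * Complex.I))))
    (hφreg' : HolderOn α (deriv fun θ : ℝ => φ (Complex.exp (θ * Complex.I))) Set.univ)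
    (hφ0 : ∀ w ∈ upperArc, φ w = 0)
    (hφneg : ∀ w ∈ lowerArc, φ w < 0)
    (A : (Fin n → ℂ) → ℝ → Matrix (Fin n) (Fin n) ℂ)
    (hA : ∀ j k, ContDiff ℝ (⊤ : ℕ∞) fun p : (Fin n → ℂ) × ℝ => A p.1 p.2 j k)
    (hA0 : ∀ w, A w 0 = 0) :
    ∀ F : ℂ → ℂ, ContinuousOn F (closedBall (0 : ℂ) 1) →
      (∀ ζ ∈ ball (0 : ℂ) 1, F ζ = schwarz φ ζ) →
    ∃ ε : ℝ, 0 < ε ∧ ∃ δ : ℝ, 0 < δ ∧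
      ∃ sol : (Fin n → ℝ) → (Fin n → ℝ) → ℝ → ℂ → Fin n → ℂ,
        (∀ (c t : Fin n → ℝ) (lam : ℝ), ‖c‖ + ‖t‖ + |lam| < δ →
          -- existence: the solution lies in X, solves the equation,
          -- and is ε-close to the model disc
          MemX α (sol c t lam) ∧
          (∀ ζ ∈ closedBall (0 : ℂ) 1, ζ ≠ 0 →
            sol c t lam ζ = bishopH F A (sol c t lam) c t lam ζ) ∧
          normX α (fun ζ => sol c t lam ζ - modelZ F c t ζ) < ε ∧
          -- uniqueness among elements of X that are ε-close to the model disc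
          (∀ w : ℂ → Fin n → ℂ, MemX α w →
            (∀ ζ ∈ closedBall (0 : ℂ) 1, ζ ≠ 0 → w ζ = bishopH F A w c t lam ζ) →
            normX α (fun ζ => w ζ - modelZ F c t ζ) < ε →
            ∀ ζ ∈ closedBall (0 : ℂ) 1, w ζ = sol c t lam ζ)) ∧
        -- smooth dependence on the parameters (c,t,λ)
        (∀ ζ ∈ closedBall (0 : ℂ) 1,
          ContDiffOn ℝ (⊤ : ℕ∞)
            (fun p : (Fin n → ℝ) × (Fin n → ℝ) × ℝ => sol p.1 p.2.1 p.2.2 ζ)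
            {p : (Fin n → ℝ) × (Fin n → ℝ) × ℝ | ‖p.1‖ + ‖p.2.1‖ + |p.2.2| < δ}) ∧
        -- for t = 0 the solution is the constant disc i·c
        (∀ (c : Fin n → ℝ) (lam : ℝ), ‖c‖ + |lam| < δ →
          ∀ ζ ∈ closedBall (0 : ℂ) 1,
            sol c 0 lam ζ = fun j => Complex.I * (c j : ℂ)) := by
  exact bishop_aux n α hα φ hφreg hφreg' hφ0 hφneg A hA hA0
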